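/- For every C > 0 and ε > 0 there exists D₀ = D₀(C, ε) such that the following holds for every integer D ≥ D₀. Let G₁, …, G_m be graphs that (i) are nearly disjoint and (ii) satisfy |{i ∈ [m] : v ∈ V(G_i)}| ≤ C for every v ∈ ⋃_{i=1}^m V(G_i). If L is a list assignment for G := ⋃_{i=1}^m G_i satisfying (iii) Δ(G_i, L|_{V(G_i)}) ≤ D for every i ∈ [m] and (iv) |L(v)| ≥ (1 + ε)D for every v ∈ V(G), then G is L-colorable. -/

import Mathlib

open Finset

namespace NearlyDisjoint

/-! ### Finite product probability spaces -/

section DeterminedBy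

variable {I Ω : Type*}

/-- The event `E` is determined by the coordinates in `T`. -/
def DeterminedBy (E : Set (I → Ω)) (T : Set I) : Prop := DependsOn (fun ω => ω ∈ E) T

lemma DeterminedBy.dependsOn {E : Set (I → Ω)} {T : Set I} (h : DeterminedBy E T) :
    DependsOn (E.indicator (1 : (I → Ω) → ℝ)) T := fun x y hxy => by
  have : (x ∈ E) = (y ∈ E) := h hxy
  by_cases hx : x ∈ E
  · have hy := this ▸ hx
    simp [hx, hy]
  · have hy : y ∉ E := this ▸ hx
    simp [hx, hy]

lemma determinedBy_inactive (T : Finset I) :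
    DeterminedBy {ω : I → Bool | ∀ i ∈ T, ω i = false} T := fun x y h => by
  simp only [Set.mem_ofPred_eq, eq_iff_iff]
  exact forall₂_congr fun i hi => by rw [h i hi]

end DeterminedBy

section Product

variable {I Ω : Type*} [Fintype Ω]

/-- `w` assigns to each coordinate a probability distribution on `Ω`. -/
structure IsWeight (w : I → Ω → ℝ) : Prop where
  nonneg : ∀ i x, 0 ≤ w i x
  sum_eq_one : ∀ i, ∑ x, w i x = 1

variable [Fintype I] [DecidableEq I]

/-- Expectation with respect to the product of the distributions `w i`. -/
def expect (w : I → Ω → ℝ) (f : (I → Ω) → ℝ) : ℝ := ∑ ω, (∏ i, w i (ω i)) * f ω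

/-- Probability with respect to the product of the distributions `w i`. -/
noncomputable def prob (w : I → Ω → ℝ) (E : Set (I → Ω)) : ℝ := expect w (E.indicator 1)

variable {w : I → Ω → ℝ}

lemma expect_mono (hw : IsWeight w) {f g : (I → Ω) → ℝ} (h : ∀ ω, f ω ≤ g ω) :
    expect w f ≤ expect w g :=
  sum_le_sum fun ω _ => mul_le_mul_of_nonneg_left (h ω) (prod_nonneg fun i _ => hw.nonneg i _)

lemma expect_sum {β : Type*} (s : Finset β) (f : β → (I → Ω) → ℝ) :
    expect w (fun ω => ∑ b ∈ s, f b ω) = ∑ b ∈ s, expect w (f b) := by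
  unfold expect
  simp_rw [mul_sum]
  exact sum_comm

lemma expect_const_mul (a : ℝ) (f : (I → Ω) → ℝ) :
    expect w (fun ω => a * f ω) = a * expect w f := by
  unfold expect
  rw [mul_sum]
  exact sum_congr rfl fun _ _ => by ring

lemma expect_prod_coord (g : I → Ω → ℝ) :
    expect w (fun ω => ∏ i, g i (ω i)) = ∏ i, ∑ x, w i x * g i x := by
  unfold expect
  simp_rw [← prod_mul_distrib]
  rw [prod_univ_sum, Fintype.piFinset_univ]

lemma expect_one (hw : IsWeight w) : expect w (fun _ => 1) = 1 := by
  have h := expect_prod_coord (w := w) (fun _ _ => 1)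
  simpa [hw.sum_eq_one] using h

lemma expect_mul_of_dependsOn (hw : IsWeight w) {f g : (I → Ω) → ℝ} {S T : Set I}
    (hf : DependsOn f S) (hg : DependsOn g T) (hST : Disjoint S T) :
    expect w (fun ω => f ω * g ω) = expect w f * expect w g := by
  classical
  let e := Equiv.piEquivPiSubtypeProd (fun i => i ∈ S) (fun _ : I => Ω)
  have key : ∀ h : (I → Ω) → ℝ, expect w h =
      ∑ a : (∀ i : {i // i ∈ S}, Ω), ∑ b : (∀ i : {i // i ∉ S}, Ω),
        (∏ i, w i.1 (a i)) * (∏ i, w i.1 (b i)) * h (e.symm (a, b)) := by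
    intro h
    unfold expect
    rw [← e.symm.sum_comp, Fintype.sum_prod_type]
    refine sum_congr rfl fun a _ => sum_congr rfl fun b _ => ?_
    congr 1
    rw [← Fintype.prod_subtype_mul_prod_subtype (fun i => i ∈ S)]
    congr 1
    · refine prod_congr rfl fun i _ => ?_
      simp [e, Equiv.piEquivPiSubtypeProd, i.2]
    · refine prod_congr rfl fun i _ => ?_
      simp [e, Equiv.piEquivPiSubtypeProd, i.2]
  have hone : ∀ p : I → Prop, ∀ [DecidablePred p],
      ∑ a : (∀ i : {i // p i}, Ω), ∏ i, w i.1 (a i) = 1 := by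
    intro p _
    have := prod_univ_sum (fun _ : {i // p i} => (univ : Finset Ω)) (fun i x => w i.1 x)
    rw [Fintype.piFinset_univ] at this
    rw [← this]
    simp [hw.sum_eq_one]
  rcases isEmpty_or_nonempty (I → Ω) with hE | ⟨⟨ω₀⟩⟩
  · simp [expect]
  let f' : (∀ i : {i // i ∈ S}, Ω) → ℝ := fun a => f (e.symm (a, fun i => ω₀ i))
  let g' : (∀ i : {i // i ∉ S}, Ω) → ℝ := fun b => g (e.symm (fun i => ω₀ i, b))
  have hf' : ∀ a b, f (e.symm (a, b)) = f' a := by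
    intro a b
    refine hf fun i hi => ?_
    simp [e, Equiv.piEquivPiSubtypeProd, hi]
  have hg' : ∀ a b, g (e.symm (a, b)) = g' b := by
    intro a b
    refine hg fun i hi => ?_
    have : i ∉ S := fun h => Set.disjoint_left.1 hST h hi
    simp [e, Equiv.piEquivPiSubtypeProd, this]
  have e1 : expect w f = ∑ a, (∏ i, w i.1 (a i)) * f' a := by
    rw [key]
    refine sum_congr rfl fun a _ => ?_
    calc _ = ∑ b : (∀ i : {i // i ∉ S}, Ω), (∏ i, w i.1 (b i)) * ((∏ i, w i.1 (a i)) * f' a) :=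
          sum_congr rfl fun b _ => by rw [hf']; ring
      _ = _ := by rw [← sum_mul, hone, one_mul]
  have e2 : expect w g = ∑ b, (∏ i, w i.1 (b i)) * g' b := by
    rw [key, sum_comm]
    refine sum_congr rfl fun b _ => ?_
    calc _ = ∑ a : (∀ i : {i // i ∈ S}, Ω), (∏ i, w i.1 (a i)) * ((∏ i, w i.1 (b i)) * g' b) :=
          sum_congr rfl fun a _ => by rw [hg']; ring
      _ = _ := by rw [← sum_mul, hone, one_mul]
  rw [key, e1, e2, sum_mul_sum]
  refine sum_congr rfl fun a _ => sum_congr rfl fun b _ => ?_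
  rw [hf', hg']
  ring

lemma expect_prod_of_dependsOn {β : Type*} (hw : IsWeight w) (J : Finset β)
    (f : β → (I → Ω) → ℝ) (T : β → Set I) (hf : ∀ b ∈ J, DependsOn (f b) (T b))
    (hT : ∀ b ∈ J, ∀ b' ∈ J, b ≠ b' → Disjoint (T b) (T b')) :
    expect w (fun ω => ∏ b ∈ J, f b ω) = ∏ b ∈ J, expect w (f b) := by
  classical
  induction J using Finset.induction_on with
  | empty => simpa using expect_one hw
  | insert a J ha ih =>
    simp_rw [prod_insert ha]
    have hdep : DependsOn (fun ω => ∏ b ∈ J, f b ω) (⋃ b ∈ J, T b) := fun x y h => by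
      refine prod_congr rfl fun b hb => hf b (mem_insert_of_mem hb) fun i hi => h i ?_
      exact Set.mem_biUnion (s := (J : Set β)) hb hi
    rw [expect_mul_of_dependsOn hw (hf a (mem_insert_self a J)) hdep]
    · rw [ih (fun b hb => hf b (mem_insert_of_mem hb))
        fun b hb b' hb' => hT b (mem_insert_of_mem hb) b' (mem_insert_of_mem hb')]
    · simp only [Set.disjoint_iUnion_right]
      intro b hb
      exact hT a (mem_insert_self a J) b (mem_insert_of_mem hb) (by rintro rfl; exact ha hb)

lemma prob_mono (hw : IsWeight w) {E F : Set (I → Ω)} (h : E ⊆ F) : prob w E ≤ prob w F :=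
  expect_mono hw fun ω => Set.indicator_le_indicator_of_subset h (fun _ => zero_le_one) ω

lemma prob_nonneg (hw : IsWeight w) (E : Set (I → Ω)) : 0 ≤ prob w E :=
  sum_nonneg fun ω _ => mul_nonneg (prod_nonneg fun i _ => hw.nonneg i _)
    (Set.indicator_nonneg (fun _ _ => zero_le_one) ω)

lemma prob_univ (hw : IsWeight w) : prob w Set.univ = 1 := by
  simpa [prob, Pi.one_def] using expect_one hw

@[simp] lemma prob_empty : prob w ∅ = 0 := by simp [prob, expect]

lemma prob_diff_add_inter (E F : Set (I → Ω)) : prob w (E \ F) + prob w (F ∩ E) = prob w E := by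
  unfold prob expect
  rw [← sum_add_distrib]
  refine sum_congr rfl fun ω _ => ?_
  by_cases h1 : ω ∈ E <;> by_cases h2 : ω ∈ F <;> simp [h1, h2]

lemma prob_compl (hw : IsWeight w) (E : Set (I → Ω)) : prob w Eᶜ = 1 - prob w E := by
  have h := prob_diff_add_inter (w := w) Set.univ E
  rw [prob_univ hw, ← Set.compl_eq_univ_sdiff, Set.inter_univ] at h
  linarith

lemma prob_biUnion_le {β : Type*} (hw : IsWeight w) (J : Finset β) (E : β → Set (I → Ω)) :
    prob w (⋃ b ∈ J, E b) ≤ ∑ b ∈ J, prob w (E b) := by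
  unfold prob
  rw [← expect_sum]
  refine expect_mono hw fun ω => ?_
  by_cases h : ω ∈ ⋃ b ∈ J, E b
  · rw [Set.indicator_of_mem h]
    simp only [Set.mem_iUnion] at h
    obtain ⟨b, hb, hω⟩ := h
    have := single_le_sum (f := fun b => (E b).indicator (1 : (I → Ω) → ℝ) ω)
      (fun b _ => Set.indicator_nonneg (fun _ _ => zero_le_one) ω) hb
    simpa [hω] using this
  · rw [Set.indicator_of_notMem h]
    exact sum_nonneg fun b _ => Set.indicator_nonneg (fun _ _ => zero_le_one) ω

lemma sum_prob_le_prob_biUnion {β : Type*} (hw : IsWeight w) (J : Finset β)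
    (E : β → Set (I → Ω)) (hE : ∀ b ∈ J, ∀ b' ∈ J, b ≠ b' → Disjoint (E b) (E b')) :
    ∑ b ∈ J, prob w (E b) ≤ prob w (⋃ b ∈ J, E b) := by
  classical
  unfold prob
  rw [← expect_sum]
  refine expect_mono hw fun ω => ?_
  by_cases h : ω ∈ ⋃ b ∈ J, E b
  · rw [Set.indicator_of_mem h]
    simp only [Set.mem_iUnion] at h
    obtain ⟨b, hb, hω⟩ := h
    rw [sum_eq_single_of_mem b hb]
    · simp [hω]
    · intro b' hb' hne
      rw [Set.indicator_of_notMem]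
      exact fun h' => Set.disjoint_left.1 (hE b' hb' b hb hne) h' hω
  · rw [Set.indicator_of_notMem h]
    refine (sum_eq_zero fun b hb => Set.indicator_of_notMem (fun h' => h ?_) _).le
    exact Set.mem_biUnion (s := (J : Set β)) hb h'

lemma prob_inter_of_disjoint (hw : IsWeight w) {E F : Set (I → Ω)} {S T : Set I}
    (hE : DeterminedBy E S) (hF : DeterminedBy F T) (hST : Disjoint S T) :
    prob w (E ∩ F) = prob w E * prob w F := by
  unfold prob
  rw [← expect_mul_of_dependsOn hw hE.dependsOn hF.dependsOn hST]
  congr 1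
  ext ω
  by_cases h1 : ω ∈ E <;> by_cases h2 : ω ∈ F <;> simp [h1, h2]

lemma prob_biInter_of_disjoint {β : Type*} (hw : IsWeight w) (J : Finset β)
    (E : β → Set (I → Ω)) (T : β → Set I) (hE : ∀ b ∈ J, DeterminedBy (E b) (T b))
    (hT : ∀ b ∈ J, ∀ b' ∈ J, b ≠ b' → Disjoint (T b) (T b')) :
    prob w (⋂ b ∈ J, E b) = ∏ b ∈ J, prob w (E b) := by
  classical
  unfold prob
  rw [← expect_prod_of_dependsOn hw J _ T (fun b hb => (hE b hb).dependsOn) hT]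
  congr 1
  ext ω
  by_cases h : ω ∈ ⋂ b ∈ J, E b
  · rw [Set.indicator_of_mem h]
    simp only [Set.mem_iInter] at h
    exact (prod_eq_one fun b hb => by simp [h b hb]).symm
  · rw [Set.indicator_of_notMem h]
    simp only [Set.mem_iInter, not_forall] at h
    obtain ⟨b, hb, hω⟩ := h
    exact (prod_eq_zero hb (by simp [hω])).symm

/-- **Lovász local lemma**, symmetric form, for events determined by few coordinates of a
product space. -/
theorem exists_forall_notMem {κ : Type*} (hw : IsWeight w) (K : Finset κ)
    (E : κ → Set (I → Ω)) (T : κ → Finset I) (hE : ∀ k ∈ K, DeterminedBy (E k) (T k))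
    {s r : ℕ} {p : ℝ} (hs : ∀ k ∈ K, (T k).card ≤ s)
    (hr : ∀ x, ∃ Q : Finset κ, Q.card ≤ r ∧ ∀ k ∈ K, x ∈ T k → k ∈ Q)
    (hp : ∀ k ∈ K, prob w (E k) ≤ p) (hp0 : 0 ≤ p) (h4 : 4 * p * (s * r + 1) ≤ 1) :
    ∃ ω, ∀ k ∈ K, ω ∉ E k := by
  classical
  let Av : Finset κ → Set (I → Ω) := fun Q => {ω | ∀ l ∈ Q, ω ∉ E l}
  have hp4 : 4 * p ≤ 1 := by
    have : 0 ≤ 4 * p * (s * r) := by positivity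
    linarith
  have main : ∀ n : ℕ, ∀ Q ⊆ K, Q.card = n → ∀ k ∈ K,
      prob w (E k ∩ Av Q) ≤ 2 * p * prob w (Av Q) := by
    intro n
    induction n using Nat.strong_induction_on with
    | _ n ih =>
      intro Q hQ hn k hk
      let Q₁ := Q.filter fun l => ¬ Disjoint (T l) (T k)
      let Q₂ := Q.filter fun l => Disjoint (T l) (T k)
      have hQ₂ : Q₂ ⊆ K := (filter_subset _ _).trans hQ
      have hcard : (Q₁.card : ℝ) ≤ s * r := by
        choose B hB hB' using hr
        have hsub : Q₁ ⊆ (T k).biUnion B := by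
          intro l hl
          obtain ⟨hlQ, hl'⟩ := mem_filter.1 hl
          obtain ⟨x, hx, hx'⟩ := not_disjoint_iff.1 hl'
          exact mem_biUnion.2 ⟨x, hx', hB' x l (hQ hlQ) hx⟩
        have h1 : Q₁.card ≤ s * r := (card_le_card hsub).trans <|
          (card_biUnion_le_card_mul _ _ r fun x _ => hB x).trans
            (Nat.mul_le_mul_right r (hs k hk))
        exact_mod_cast h1
      have hind : prob w (E k ∩ Av Q₂) = prob w (E k) * prob w (Av Q₂) := by
        refine prob_inter_of_disjoint hw (S := T k) (T := ⋃ l ∈ Q₂, (T l : Set I)) (hE k hk) ?_ ?_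
        · intro x y hxy
          have : ∀ l ∈ Q₂, (x ∈ E l) = (y ∈ E l) := fun l hl =>
            hE l (hQ₂ hl) fun i hi => hxy i (Set.mem_biUnion (s := (Q₂ : Set κ)) hl hi)
          simp only [Av, Set.mem_ofPred_eq, eq_iff_iff]
          exact forall₂_congr fun l hl => by rw [this l hl]
        · simp only [Set.disjoint_iUnion_right]
          intro l hl
          exact_mod_cast (mem_filter.1 hl).2.symm
      have h1 : prob w (E k ∩ Av Q) ≤ p * prob w (Av Q₂) := by
        refine (prob_mono hw ?_).trans (hind.le.trans
          (mul_le_mul_of_nonneg_right (hp k hk) (prob_nonneg hw _)))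
        exact Set.inter_subset_inter_right _ fun ω hω l hl => hω l (mem_filter.1 hl).1
      have h2 : prob w (Av Q₂) - ∑ l ∈ Q₁, prob w (E l ∩ Av Q₂) ≤ prob w (Av Q) := by
        have h3 := prob_diff_add_inter (w := w) (Av Q₂) (⋃ l ∈ Q₁, E l ∩ Av Q₂)
        have h4 : prob w (Av Q₂ \ ⋃ l ∈ Q₁, E l ∩ Av Q₂) ≤ prob w (Av Q) := by
          refine prob_mono hw fun ω hω l hl hEl => ?_
          by_cases hd : Disjoint (T l) (T k)
          · exact hω.1 l (mem_filter.2 ⟨hl, hd⟩) hEl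
          · exact hω.2 (Set.mem_biUnion (s := (Q₁ : Set κ)) (mem_filter.2 ⟨hl, hd⟩) ⟨hEl, hω.1⟩)
        have h5 : prob w ((⋃ l ∈ Q₁, E l ∩ Av Q₂) ∩ Av Q₂) ≤ ∑ l ∈ Q₁, prob w (E l ∩ Av Q₂) :=
          (prob_mono hw Set.inter_subset_left).trans (prob_biUnion_le hw _ _)
        linarith
      have h3 : ∑ l ∈ Q₁, prob w (E l ∩ Av Q₂) ≤ (s * r) * (2 * p * prob w (Av Q₂)) := by
        rcases Q₁.eq_empty_or_nonempty with h0 | ⟨l₀, hl₀⟩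
        · rw [h0, sum_empty]
          have := prob_nonneg hw (Av Q₂)
          positivity
        · have hlt : Q₂.card < n := by
            rw [← hn]
            refine card_lt_card ⟨filter_subset _ _, fun h => ?_⟩
            exact (mem_filter.1 hl₀).2 (mem_filter.1 (h (mem_filter.1 hl₀).1)).2
          have hb : ∀ l ∈ Q₁, prob w (E l ∩ Av Q₂) ≤ 2 * p * prob w (Av Q₂) := fun l hl =>
            ih _ hlt Q₂ hQ₂ rfl l (hQ (mem_filter.1 hl).1)
          refine (sum_le_card_nsmul _ _ _ hb).trans ?_
          rw [nsmul_eq_mul]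
          refine mul_le_mul_of_nonneg_right hcard ?_
          have := prob_nonneg hw (Av Q₂)
          positivity
      have h0 := prob_nonneg hw (Av Q₂)
      nlinarith [mul_nonneg hp0 h0]
  have hpos : ∀ Q ⊆ K, 0 < prob w (Av Q) := by
    intro Q
    induction Q using Finset.induction_on with
    | empty =>
      intro _
      have : Av ∅ = Set.univ := by ext; simp [Av]
      rw [this, prob_univ hw]
      exact one_pos
    | insert k Q hk ih =>
      intro hQ
      have hQ' : Q ⊆ K := (subset_insert _ _).trans hQ
      have h1 := main _ Q hQ' rfl k (hQ (mem_insert_self _ _))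
      have h2 := prob_diff_add_inter (w := w) (Av Q) (E k)
      have h3 : prob w (Av Q \ E k) ≤ prob w (Av (insert k Q)) := by
        refine prob_mono hw fun ω hω l hl => ?_
        rcases mem_insert.1 hl with rfl | hl
        · exact hω.2
        · exact hω.1 l hl
      have h4 := ih hQ'
      nlinarith
  by_contra! hcon
  have h := hpos K subset_rfl
  have : Av K = ∅ := by
    ext ω
    obtain ⟨k, hk, hω⟩ := hcon ω
    simp only [Av, Set.mem_ofPred_eq, Set.mem_empty_iff_false, iff_false, not_forall, not_not]
    exact ⟨k, hk, hω⟩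
  rw [this, prob_empty] at h
  exact lt_irrefl _ h

open Classical in
/-- Upper tail bound for a sum of indicators whose `k`-wise joint probabilities are small. -/
lemma prob_le_card_mul_pow_le {β : Type*} (hw : IsWeight w) (U : Finset β)
    (E : β → Set (I → Ω)) {n k t : ℕ} {s : ℝ} (hs : 0 ≤ s) (hU : U.card ≤ n)
    (hE : ∀ W ⊆ U, W.card = k → prob w (⋂ u ∈ W, E u) ≤ s ^ k) :
    prob w {ω | t ≤ (U.filter fun u => ω ∈ E u).card} * ((t + 1 - k : ℕ) : ℝ) ^ k
      ≤ (n * s) ^ k := by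
  set X : Set (I → Ω) := {ω | t ≤ (U.filter fun u => ω ∈ E u).card} with hX
  have h1 : (t.choose k : ℝ) * prob w X ≤ n.choose k * s ^ k := by
    calc (t.choose k : ℝ) * prob w X
        = expect w (fun ω => (t.choose k : ℝ) * X.indicator 1 ω) := by
          rw [expect_const_mul]; rfl
      _ ≤ expect w (fun ω => ∑ W ∈ U.powersetCard k, (⋂ u ∈ W, E u).indicator 1 ω) := by
          refine expect_mono hw fun ω => ?_
          by_cases hω : ω ∈ X
          · rw [Set.indicator_of_mem hω]
            have hsub : (U.filter fun u => ω ∈ E u).powersetCard k ⊆ U.powersetCard k :=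
              powersetCard_mono (filter_subset _ _)
            refine le_trans ?_ (sum_le_sum_of_subset_of_nonneg hsub fun W _ _ =>
              Set.indicator_nonneg (fun _ _ => zero_le_one) ω)
            rw [sum_congr rfl (g := fun _ => (1 : ℝ))]
            · simp only [sum_const, card_powersetCard, nsmul_eq_mul, mul_one, Pi.one_apply]
              exact_mod_cast Nat.choose_le_choose k hω
            · intro W hW
              rw [Set.indicator_of_mem]
              · rfl
              · simp only [Set.mem_iInter]
                exact fun u hu => (mem_filter.1 ((mem_powersetCard.1 hW).1 hu)).2
          · rw [Set.indicator_of_notMem hω, mul_zero]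
            exact sum_nonneg fun W _ => Set.indicator_nonneg (fun _ _ => zero_le_one) ω
      _ = ∑ W ∈ U.powersetCard k, prob w (⋂ u ∈ W, E u) := expect_sum _ _
      _ ≤ ∑ W ∈ U.powersetCard k, s ^ k := sum_le_sum fun W hW =>
          hE W (mem_powersetCard.1 hW).1 (mem_powersetCard.1 hW).2
      _ = U.card.choose k * s ^ k := by simp
      _ ≤ n.choose k * s ^ k := by
          gcongr

  have hX0 := prob_nonneg hw X
  have ht : ((t + 1 - k : ℕ) : ℝ) ^ k ≤ k.factorial * t.choose k := by
    have := Nat.pow_sub_le_descFactorial t k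
    rw [Nat.descFactorial_eq_factorial_mul_choose] at this
    exact_mod_cast this
  have hn : (k.factorial : ℝ) * n.choose k ≤ (n : ℝ) ^ k := by
    have := Nat.descFactorial_le_pow n k
    rw [Nat.descFactorial_eq_factorial_mul_choose] at this
    exact_mod_cast this
  calc prob w X * ((t + 1 - k : ℕ) : ℝ) ^ k ≤ prob w X * (k.factorial * t.choose k) := by gcongr
    _ = k.factorial * (t.choose k * prob w X) := by ring
    _ ≤ k.factorial * (n.choose k * s ^ k) := by gcongr
    _ = (k.factorial * n.choose k) * s ^ k := by ring
    _ ≤ n ^ k * s ^ k := by gcongr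
    _ = (n * s) ^ k := (mul_pow _ _ _).symm

end Product

/-! ### Bernoulli product spaces -/

section Bernoulli

variable {I : Type*} {α : ℝ}

/-- Every coordinate is `true` with probability `α`. -/
def bernoulli (I : Type*) (α : ℝ) : I → Bool → ℝ := fun _ b => if b then α else 1 - α

lemma isWeight_bernoulli (h0 : 0 ≤ α) (h1 : α ≤ 1) : IsWeight (bernoulli I α) where
  nonneg _ x := by cases x <;> simp [bernoulli, h0, h1]
  sum_eq_one _ := by simp [bernoulli]

variable [Fintype I] [DecidableEq I]

lemma prob_bernoulli_inactive (T : Finset I) :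
    prob (bernoulli I α) {ω | ∀ i ∈ T, ω i = false} = (1 - α) ^ T.card := by
  have h := expect_prod_coord (w := bernoulli I α)
    (fun i b => if i ∈ T then (if b then 0 else 1) else 1)
  have h2 : ∀ i, (∑ x, bernoulli I α i x * if i ∈ T then (if x then 0 else 1) else 1)
      = if i ∈ T then 1 - α else 1 := by
    intro i
    by_cases hi : i ∈ T <;> simp [bernoulli, hi]
  simp_rw [h2] at h
  rw [prod_ite_mem, univ_inter, prod_const] at h
  rw [← h]
  unfold prob
  congr 1
  ext ω
  rw [prod_ite_mem, univ_inter]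
  by_cases hω : ω ∈ {ω : I → Bool | ∀ i ∈ T, ω i = false}
  · rw [Set.indicator_of_mem hω]
    exact (prod_eq_one fun i hi => by simp [hω i hi]).symm
  · rw [Set.indicator_of_notMem hω]
    simp only [Set.mem_ofPred_eq, not_forall, Bool.not_eq_false] at hω
    obtain ⟨i, hi, hωi⟩ := hω
    exact (prod_eq_zero hi (by simp [hωi])).symm

lemma prob_bernoulli_active {x : I} {T : Finset I} (hx : x ∉ T) :
    prob (bernoulli I α) {ω | ω x = true ∧ ∀ i ∈ T, ω i = false} = α * (1 - α) ^ T.card := by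
  have h := prob_diff_add_inter (w := bernoulli I α)
    {ω | ∀ i ∈ T, ω i = false} {ω | ∀ i ∈ insert x T, ω i = false}
  have hsub : {ω : I → Bool | ∀ i ∈ insert x T, ω i = false} ⊆ {ω | ∀ i ∈ T, ω i = false} :=
    fun ω hω i hi => hω i (mem_insert_of_mem hi)
  rw [Set.inter_eq_left.2 hsub,
    prob_bernoulli_inactive, prob_bernoulli_inactive, card_insert_of_notMem hx] at h
  have he : {ω : I → Bool | ω x = true ∧ ∀ i ∈ T, ω i = false} =
      {ω | ∀ i ∈ T, ω i = false} \ {ω | ∀ i ∈ insert x T, ω i = false} := by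
    ext ω
    simp only [Set.mem_ofPred_eq, Set.mem_sdiff, mem_insert, forall_eq_or_imp, not_and]
    constructor
    · rintro ⟨h1, h2⟩
      exact ⟨h2, fun h3 => by simp [h1] at h3⟩
    · rintro ⟨h1, h2⟩
      refine ⟨?_, h1⟩
      by_contra h3
      exact h2 (by simpa using h3) h1
  rw [he]
  linear_combination h

end Bernoulli

/-! ### List colorings of nearly disjoint graphs -/

section Coloring

variable {V Γ ι : Type*} [Fintype V] [DecidableEq V] [DecidableEq Γ] [Fintype ι]

/-- The graphs `G i` on vertex sets `S i` are nearly disjoint and every vertex lies in at most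
`C` of the sets `S i`. -/
structure IsNearlyDisjoint (G : ι → SimpleGraph V) (S : ι → Finset V) (C : ℕ) : Prop where
  mem : ∀ i u v, (G i).Adj u v → u ∈ S i
  card_inter : ∀ i j, i ≠ j → (S i ∩ S j).card ≤ 1
  card_filter : ∀ v, (univ.filter fun i => v ∈ S i).card ≤ C

open Classical in
/-- The neighbors of `v` in `H` that have `c` in their list. -/
noncomputable def colorNbrs (H : SimpleGraph V) (L : V → Finset Γ) (v : V) (c : Γ) : Finset V :=
  univ.filter fun u => H.Adj v u ∧ c ∈ L u

/-- All color degrees in all graphs `G i` are at most `D`. -/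
def ColorDegreeLE (G : ι → SimpleGraph V) (L : V → Finset Γ) (D : ℕ) : Prop :=
  ∀ i v, ∀ c ∈ L v, (colorNbrs (G i) L v c).card ≤ D

/-- All vertices with a nonempty list can be colored from their lists, properly in every `G i`. -/
def HasListColoring (G : ι → SimpleGraph V) (L : V → Finset Γ) : Prop :=
  ∃ φ : V → Γ, (∀ v, (L v).Nonempty → φ v ∈ L v) ∧
    ∀ i u v, (G i).Adj u v → (L u).Nonempty → (L v).Nonempty → φ u ≠ φ v

/-- The neighbors of `v` in any of the graphs `G i` that have `c` in their list. -/
noncomputable def allNbrs (G : ι → SimpleGraph V) (L : V → Finset Γ) (v : V) (c : Γ) : Finset V :=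
  univ.biUnion fun i => colorNbrs (G i) L v c

variable {G : ι → SimpleGraph V} {S : ι → Finset V} {L L' : V → Finset Γ} {C D ℓ : ℕ}

omit [Fintype ι] [DecidableEq V] in
@[simp] lemma mem_colorNbrs {H : SimpleGraph V} {u v : V} {c : Γ} :
    u ∈ colorNbrs H L v c ↔ H.Adj v u ∧ c ∈ L u := by
  simp [colorNbrs]

@[simp] lemma mem_allNbrs {u v : V} {c : Γ} :
    u ∈ allNbrs G L v c ↔ ∃ i, (G i).Adj v u ∧ c ∈ L u := by
  simp [allNbrs]

omit [DecidableEq V] [Fintype ι] in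
lemma ColorDegreeLE.mono (h : ColorDegreeLE G L D) (hL : ∀ v, L' v ⊆ L v) :
    ColorDegreeLE G L' D := fun i v c hc =>
  (card_le_card fun u hu => by
    rw [mem_colorNbrs] at hu ⊢
    exact ⟨hu.1, hL u hu.2⟩).trans (h i v c (hL v hc))

lemma card_allNbrs_le (hG : IsNearlyDisjoint G S C) (hD : ColorDegreeLE G L D) {v : V} {c : Γ}
    (hc : c ∈ L v) : (allNbrs G L v c).card ≤ C * D := by
  have hsub : allNbrs G L v c ⊆
      (univ.filter fun i => v ∈ S i).biUnion fun i => colorNbrs (G i) L v c := by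
    intro u hu
    obtain ⟨i, hi, hu'⟩ := mem_allNbrs.1 hu
    exact mem_biUnion.2 ⟨i, mem_filter.2 ⟨mem_univ _, hG.mem i v u hi⟩, mem_colorNbrs.2 ⟨hi, hu'⟩⟩
  exact (card_le_card hsub).trans <| (card_biUnion_le_card_mul _ _ D fun i _ => hD i v c hc).trans
    (Nat.mul_le_mul_right D (hG.card_filter v))

omit [Fintype V] [DecidableEq V] [DecidableEq Γ] [Fintype ι] in
lemma HasListColoring.of_subset (h : HasListColoring G L') (hL : ∀ v, L' v ⊆ L v)
    (hne : ∀ v, (L v).Nonempty → (L' v).Nonempty) : HasListColoring G L := by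
  obtain ⟨φ, h1, h2⟩ := h
  exact ⟨φ, fun v hv => hL v (h1 v (hne v hv)),
    fun i u v huv hu hv => h2 i u v huv (hne u hu) (hne v hv)⟩

omit [Fintype V] [DecidableEq V] [DecidableEq Γ] in
lemma exists_truncation (hℓ : 0 < ℓ) (hL : ∀ v, L v = ∅ ∨ ℓ ≤ (L v).card) :
    ∃ L' : V → Finset Γ, (∀ v, L' v ⊆ L v) ∧ (∀ v, (L v).Nonempty → (L' v).Nonempty) ∧
      ∀ v, L' v = ∅ ∨ (L' v).card = ℓ := by
  have : ∀ v, ∃ A ⊆ L v, ((L v).Nonempty → A.Nonempty) ∧ (A = ∅ ∨ A.card = ℓ) := by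
    intro v
    rcases hL v with h | h
    · exact ⟨∅, empty_subset _, by simp [h], Or.inl rfl⟩
    · obtain ⟨A, hA, hAc⟩ := exists_subset_card_eq h
      exact ⟨A, hA, fun _ => card_pos.1 (hAc ▸ hℓ), Or.inr hAc⟩
  choose L' h1 h2 h3 using this
  exact ⟨L', h1, h2, h3⟩

omit [Fintype V] [DecidableEq V] [DecidableEq Γ] [Fintype ι] in
lemma prob_coord_mem {I Ω : Type*} [Fintype I] [DecidableEq I] [Fintype Ω] {w : I → Ω → ℝ}
    (hw : IsWeight w) (u : I) (p : Ω → Prop) [DecidablePred p] :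
    prob w {ω | p (ω u)} = ∑ x with p x, w u x := by
  have h := expect_prod_coord (w := w)
    (fun i b => if i = u then (if p b then 1 else 0) else 1)
  have h2 : ∀ i, (∑ x, w i x * if i = u then (if p x then 1 else 0) else 1)
      = if i = u then ∑ x with p x, w u x else 1 := by
    intro i
    by_cases hi : i = u
    · subst hi
      simp [sum_filter]
    · simp [hi, hw.sum_eq_one]
  simp_rw [h2] at h
  rw [prod_ite_eq' univ u] at h
  simp only [mem_univ, if_true] at h
  rw [← h]
  unfold prob
  congr 1
  ext ω
  rw [prod_ite_eq' univ u (fun i => if p (ω i) then (1 : ℝ) else 0)]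
  simp [Set.indicator_apply]

/-- Lists much longer than all color degrees suffice. -/
lemma hasListColoring_of_large [Nonempty Γ] (hG : IsNearlyDisjoint G S C)
    (hD : ColorDegreeLE G L D) (hℓ : 16 * C * D + 4 ≤ ℓ) (hL : ∀ v, L v = ∅ ∨ ℓ ≤ (L v).card) :
    HasListColoring G L := by
  classical
  have hℓ0 : 0 < ℓ := by omega
  obtain ⟨L', hsub, hne, hL'⟩ := exists_truncation hℓ0 hL
  refine HasListColoring.of_subset ?_ hsub hne
  replace hD := hD.mono hsub
  clear hne hsub hL
  have : Nonempty (Fin ℓ) := ⟨⟨0, hℓ0⟩⟩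
  have hf : ∀ v, ∃ f : Fin ℓ → Γ, (L' v).Nonempty → (∀ x, f x ∈ L' v) ∧ Function.Injective f := by
    intro v
    rcases hL' v with h | h
    · exact ⟨fun _ => Classical.arbitrary Γ, by simp [h]⟩
    · refine ⟨fun x => ((L' v).equivFinOfCardEq h).symm x, fun _ => ⟨fun x => ?_, ?_⟩⟩
      · exact Subtype.prop _
      · exact Subtype.val_injective.comp (Equiv.injective _)
  choose f hf using hf
  let w : V → Fin ℓ → ℝ := fun _ _ => 1 / ℓ
  have hℓr : (0 : ℝ) < ℓ := by exact_mod_cast hℓ0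
  have hw : IsWeight w := ⟨fun _ _ => by positivity, fun _ => by simp [w, hℓr.ne']⟩
  let K : Finset (V × V × Γ) :=
    (univ ×ˢ univ ×ˢ univ.biUnion L').filter fun k =>
      (∃ i, (G i).Adj k.1 k.2.1) ∧ k.2.2 ∈ L' k.1 ∧ k.2.2 ∈ L' k.2.1
  let F : V → Γ → Set (V → Fin ℓ) := fun u c => {ω | f u (ω u) = c}
  have hFd : ∀ u c, DeterminedBy (F u c) {u} := fun u c x y h => by
    simp only [F, Set.mem_ofPred_eq, h u rfl]
  have hFp : ∀ u c, (L' u).Nonempty → prob w (F u c) ≤ 1 / ℓ := by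
    intro u c hu
    rw [prob_coord_mem hw u (fun x => f u x = c)]
    simp only [w, sum_const, nsmul_eq_mul]
    have h1 : (univ.filter fun x => f u x = c).card ≤ 1 :=
      card_le_one.2 fun a ha b hb => (hf u hu).2
        ((mem_filter.1 ha).2.trans (mem_filter.1 hb).2.symm)
    have h2 : ((univ.filter fun x => f u x = c).card : ℝ) ≤ 1 := by exact_mod_cast h1
    have h3 : (0 : ℝ) ≤ 1 / ℓ := by positivity
    nlinarith
  have key : ∃ ω, ∀ k ∈ K, ω ∉ F k.1 k.2.2 ∩ F k.2.1 k.2.2 := by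
    refine exists_forall_notMem hw K (fun k => F k.1 k.2.2 ∩ F k.2.1 k.2.2)
      (fun k => {k.1, k.2.1}) (s := 2) (r := 2 * (ℓ * (C * D))) (p := 1 / ℓ * (1 / ℓ))
      ?_ (fun _ _ => card_le_two) ?_ ?_ (by positivity) ?_
    · rintro ⟨u, v, c⟩ - x y hxy
      have h1 := hFd u c (x := x) (y := y) fun i hi => hxy i (by simp_all)
      have h2 := hFd v c (x := x) (y := y) fun i hi => hxy i (by simp_all)
      simp only [Set.mem_inter_iff] at h1 h2 ⊢
      rw [h1, h2]
    · intro x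
      refine ⟨((L' x).biUnion fun c => (allNbrs G L' x c).image fun v => (x, v, c)) ∪
        ((L' x).biUnion fun c => (allNbrs G L' x c).image fun v => (v, x, c)), ?_, ?_⟩
      · have hc : (L' x).card ≤ ℓ := by
          rcases hL' x with h | h <;> simp [h]
        rw [two_mul]
        refine (card_union_le _ _).trans (add_le_add ?_ ?_) <;>
        · refine (card_biUnion_le_card_mul _ _ (C * D) fun c hc =>
            card_image_le.trans (card_allNbrs_le hG hD hc)).trans (Nat.mul_le_mul_right _ hc)
      · rintro ⟨u, v, c⟩ hk hx
        obtain ⟨-, ⟨i, hi⟩, hcu, hcv⟩ := mem_filter.1 hk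
        simp only at hi hcu hcv
        rw [mem_union]
        rcases mem_insert.1 hx with h | h
        · left
          simp only at h
          subst h
          exact mem_biUnion.2 ⟨c, hcu, mem_image.2 ⟨v, mem_allNbrs.2 ⟨i, hi, hcv⟩, rfl⟩⟩
        · right
          rw [mem_singleton] at h
          simp only at h
          subst h
          exact mem_biUnion.2 ⟨c, hcv, mem_image.2 ⟨u, mem_allNbrs.2 ⟨i, hi.symm, hcu⟩, rfl⟩⟩
    · rintro ⟨u, v, c⟩ hk
      obtain ⟨-, ⟨i, hi⟩, hcu, hcv⟩ := mem_filter.1 hk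
      simp only at hi hcu hcv ⊢
      rw [prob_inter_of_disjoint hw (hFd u c) (hFd v c) (by simpa using hi.ne)]
      exact mul_le_mul (hFp u c ⟨c, hcu⟩) (hFp v c ⟨c, hcv⟩) (prob_nonneg hw _) (by positivity)
    · have h1 : (16 * C * D + 4 : ℝ) ≤ ℓ := by exact_mod_cast hℓ
      have h2 : (1 : ℝ) ≤ ℓ := by exact_mod_cast hℓ0
      push_cast
      rw [show 4 * (1 / (ℓ : ℝ) * (1 / ℓ)) * (2 * (2 * (ℓ * (C * D))) + 1)
        = (16 * C * D * ℓ + 4) / (ℓ * ℓ) by field_simp; ring, div_le_one (by positivity)]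
      nlinarith
  obtain ⟨ω, hω⟩ := key
  refine ⟨fun v => f v (ω v), fun v hv => (hf v hv).1 _, fun i u v huv hu hv heq => ?_⟩
  have hmem : f u (ω u) ∈ L' v := (show f u (ω u) = f v (ω v) from heq) ▸ (hf v hv).1 _
  refine hω (u, v, f u (ω u)) (mem_filter.2 ⟨?_, ⟨i, huv⟩, (hf u hu).1 _, hmem⟩) ⟨rfl, heq.symm⟩
  simp only [mem_product, mem_univ, true_and, mem_biUnion]
  exact ⟨u, (hf u hu).1 _⟩

end Coloring

/-! ### Blockers -/

section Blockers

/-- The independent choices of a random round: `((v, c), none)` stands for the activation of the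
color `c` at `v`, and `((v, c), some _)` for dummies that equalize the probability of losing `c`
at `v`. -/
abbrev Item (V Γ ι : Type*) (n : ℕ) := (V × Γ) × Option (Option ι × Fin n)

variable {V Γ ι : Type*} [Fintype V] [DecidableEq V] [DecidableEq Γ] [Fintype ι] [DecidableEq ι]

/-- `N u c` is a set of items whose activation makes `u` lose the color `c`, and `M i u c` is the
subset of those which do not come from the graph `G i`. -/
structure IsBlocking (G : ι → SimpleGraph V) (S : ι → Finset V) (L : V → Finset Γ) (C D : ℕ)
    {n : ℕ} (N : V → Γ → Finset (Item V Γ ι n)) (M : ι → V → Γ → Finset (Item V Γ ι n)) :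
    Prop where
  card_le : ∀ u, ∀ c ∈ L u, (N u c).card ≤ C * D
  color_eq : ∀ u c, ∀ x ∈ N u c, x.1.2 = c
  self_notMem : ∀ u c, ((u, c), none) ∉ N u c
  eq_or_adj : ∀ u c, ∀ x ∈ N u c, x.1.1 = u ∨ ∃ i, (G i).Adj u x.1.1 ∧ c ∈ L x.1.1
  mem_of_adj : ∀ i u w c, (G i).Adj u w → c ∈ L w → ((w, c), none) ∈ N u c
  subset : ∀ i u c, M i u c ⊆ N u c
  le_card : ∀ i, ∀ u ∈ S i, ∀ c ∈ L u, (C - 1) * D ≤ (M i u c).card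
  card_inter : ∀ i, ∀ u ∈ S i, ∀ u' ∈ S i, u ≠ u' → ∀ c, (M i u c ∩ M i u' c).card ≤ C ^ 2

variable {G : ι → SimpleGraph V} {S : ι → Finset V} {L : V → Finset Γ} {C D : ℕ}

lemma card_filter_fin_lt {n k : ℕ} (h : k ≤ n) :
    (univ.filter fun t : Fin n => (t : ℕ) < k).card = k := by
  simp [Fin.card_filter_val_lt, h]

theorem exists_isBlocking (hG : IsNearlyDisjoint G S C) (hD : ColorDegreeLE G L D) :
    ∃ (N : V → Γ → Finset (Item V Γ ι (C * D))) (M : ι → V → Γ → Finset (Item V Γ ι (C * D))),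
      IsBlocking G S L C D N M := by
  let R : V → Finset ι := fun u => univ.filter fun i => u ∈ S i
  let real : ι → V → Γ → Finset (Item V Γ ι (C * D)) := fun j u c =>
    (colorNbrs (G j) L u c).image fun w => ((w, c), none)
  let dummy : ι → V → Γ → Finset (Item V Γ ι (C * D)) := fun j u c =>
    (univ.filter fun t : Fin (C * D) => (t : ℕ) < D - (colorNbrs (G j) L u c).card).image
      fun t => ((u, c), some (some j, t))
  let rest : V → Γ → Finset (Item V Γ ι (C * D)) := fun u c =>
    (univ.filter fun t : Fin (C * D) => (t : ℕ) < (C - (R u).card) * D).image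
      fun t => ((u, c), some (none, t))
  let blk : ι → V → Γ → Finset (Item V Γ ι (C * D)) := fun j u c => real j u c ∪ dummy j u c
  have mem_real : ∀ j u c x, x ∈ real j u c ↔
      ∃ w, ((G j).Adj u w ∧ c ∈ L w) ∧ ((w, c), none) = x := by
    intro j u c x
    simp only [real, mem_image, mem_colorNbrs]
  have mem_dummy : ∀ j u c x, x ∈ dummy j u c → ∃ t, ((u, c), some (some j, t)) = x := by
    intro j u c x hx
    obtain ⟨t, -, ht⟩ := mem_image.1 hx
    exact ⟨t, ht⟩
  have mem_rest : ∀ u c x, x ∈ rest u c → ∃ t, ((u, c), some (none, t)) = x := by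
    intro u c x hx
    obtain ⟨t, -, ht⟩ := mem_image.1 hx
    exact ⟨t, ht⟩
  have card_real : ∀ j u c, (real j u c).card = (colorNbrs (G j) L u c).card := fun j u c =>
    card_image_of_injective _ fun a b h => by simpa using h
  have card_dummy : ∀ j, ∀ u ∈ S j, ∀ c,
      (dummy j u c).card = D - (colorNbrs (G j) L u c).card := by
    intro j u hu c
    rw [card_image_of_injective _ fun a b h => by simpa using h, card_filter_fin_lt]
    have : 1 ≤ C := (card_pos.2 ⟨j, mem_filter.2 ⟨mem_univ j, hu⟩⟩).trans_le (hG.card_filter u)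
    exact (Nat.sub_le _ _).trans (Nat.le_mul_of_pos_left D this)
  have card_rest : ∀ u c, (rest u c).card = (C - (R u).card) * D := by
    intro u c
    rw [card_image_of_injective _ fun a b h => by simpa using h, card_filter_fin_lt]
    exact Nat.mul_le_mul_right D (Nat.sub_le _ _)
  have card_blk : ∀ j, ∀ u ∈ S j, ∀ c ∈ L u, (blk j u c).card = D := by
    intro j u hu c hc
    rw [card_union_of_disjoint, card_real, card_dummy j u hu]
    · have := hD j u c hc
      omega
    · refine disjoint_left.2 fun x hx hx' => ?_
      obtain ⟨w, -, rfl⟩ := (mem_real j u c x).1 hx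
      obtain ⟨t, ht⟩ := mem_dummy j u c _ hx'
      simp at ht
  have blk_disj : ∀ j j' u c, j ≠ j' → Disjoint (blk j u c) (blk j' u c) := by
    intro j j' u c hj
    refine disjoint_left.2 fun x hx hx' => ?_
    rcases mem_union.1 hx with hx | hx <;> rcases mem_union.1 hx' with hx' | hx'
    · obtain ⟨w, ⟨hw, -⟩, rfl⟩ := (mem_real j u c x).1 hx
      obtain ⟨w', ⟨hw', -⟩, h⟩ := (mem_real j' u c _).1 hx'
      obtain rfl : w' = w := by simpa using h
      refine hw.ne (card_le_one.1 (hG.card_inter j j' hj) u ?_ w' ?_)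
      · exact mem_inter.2 ⟨hG.mem _ _ _ hw, hG.mem _ _ _ hw'⟩
      · exact mem_inter.2 ⟨hG.mem _ _ _ hw.symm, hG.mem _ _ _ hw'.symm⟩
    · obtain ⟨w, -, rfl⟩ := (mem_real j u c x).1 hx
      obtain ⟨t, ht⟩ := mem_dummy _ u c _ hx'
      simp at ht
    · obtain ⟨w, -, rfl⟩ := (mem_real j' u c x).1 hx'
      obtain ⟨t, ht⟩ := mem_dummy _ u c _ hx
      simp at ht
    · obtain ⟨t, rfl⟩ := mem_dummy _ u c _ hx
      obtain ⟨t', ht'⟩ := mem_dummy _ u c _ hx'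
      simp only [Prod.mk.injEq, Option.some.injEq, true_and] at ht'
      exact hj ht'.1.symm
  have rest_disj : ∀ j u c, Disjoint (blk j u c) (rest u c) := by
    intro j u c
    refine disjoint_left.2 fun x hx hx' => ?_
    obtain ⟨t, rfl⟩ := mem_rest u c x hx'
    rcases mem_union.1 hx with hx | hx
    · obtain ⟨w, -, hw⟩ := (mem_real j u c _).1 hx
      simp at hw
    · obtain ⟨t', ht'⟩ := mem_dummy _ u c _ hx
      simp at ht'
  have card_R : ∀ u, (R u).card ≤ C := hG.card_filter
  refine ⟨fun u c => (R u).biUnion (fun j => blk j u c) ∪ rest u c,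
    fun i u c => ((R u).erase i).biUnion (fun j => blk j u c) ∪ rest u c, ?_⟩
  have mem_cases : ∀ u c x, x ∈ (R u).biUnion (fun j => blk j u c) ∪ rest u c →
      x.1.2 = c ∧ ((x.1.1 = u ∧ x.2 ≠ none) ∨ ∃ i, (G i).Adj u x.1.1 ∧ c ∈ L x.1.1) := by
    intro u c x hx
    rcases mem_union.1 hx with hx | hx
    · obtain ⟨j, -, hx⟩ := mem_biUnion.1 hx
      rcases mem_union.1 hx with hx | hx
      · obtain ⟨w, hw, rfl⟩ := (mem_real j u c x).1 hx
        exact ⟨rfl, Or.inr ⟨j, hw⟩⟩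
      · obtain ⟨t, rfl⟩ := mem_dummy j u c x hx
        exact ⟨rfl, Or.inl ⟨rfl, by simp⟩⟩
    · obtain ⟨t, rfl⟩ := mem_rest u c x hx
      exact ⟨rfl, Or.inl ⟨rfl, by simp⟩⟩
  refine ⟨fun u c hc => ?_, fun u c x hx => (mem_cases u c x hx).1, fun u c hx => ?_,
    fun u c x hx => ?_, fun i u w c h hc => ?_, fun i u c => ?_, fun i u hu c hc => ?_,
    fun i u hu u' hu' hne c => ?_⟩
  · refine (card_union_le _ _).trans ?_
    have h1 : ((R u).biUnion fun j => blk j u c).card ≤ (R u).card * D :=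
      card_biUnion_le_card_mul _ _ D fun j hj => (card_blk j u (mem_filter.1 hj).2 c hc).le
    rw [card_rest]
    calc _ ≤ (R u).card * D + (C - (R u).card) * D := by gcongr
      _ = C * D := by rw [← add_mul, Nat.add_sub_cancel' (card_R u)]
  · rcases (mem_cases u c _ hx).2 with h | ⟨i, h, -⟩
    · exact h.2 rfl
    · exact h.ne rfl
  · rcases (mem_cases u c x hx).2 with h | h
    · exact Or.inl h.1
    · exact Or.inr h
  · refine mem_union_left _ (mem_biUnion.2 ⟨i, ?_, mem_union_left _ ?_⟩)
    · exact mem_filter.2 ⟨mem_univ i, hG.mem i u w h⟩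
    · exact (mem_real i u c _).2 ⟨w, ⟨h, hc⟩, rfl⟩
  · exact union_subset_union_left (biUnion_subset_biUnion_of_subset_left _ (erase_subset _ _))
  · rw [card_union_of_disjoint, card_biUnion, sum_congr rfl (g := fun _ => D), sum_const,
      smul_eq_mul, card_rest, ← add_mul, card_erase_of_mem]
    · refine Nat.mul_le_mul_right D ?_
      omega
    · exact mem_filter.2 ⟨mem_univ i, hu⟩
    · exact fun j hj => card_blk j u (mem_filter.1 (mem_of_mem_erase hj)).2 c hc
    · exact fun j _ j' _ hj => blk_disj j j' u c hj
    · exact (disjoint_biUnion_left _ _ _).2 fun j _ => rest_disj j u c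
  · have hsub : (((R u).erase i).biUnion (fun j => blk j u c) ∪ rest u c) ∩
        (((R u').erase i).biUnion (fun j => blk j u' c) ∪ rest u' c) ⊆
        ((R u ×ˢ R u').filter fun q => q.1 ≠ q.2).biUnion
          fun q => (S q.1 ∩ S q.2).image fun w => ((w, c), none) := by
      have hcase : ∀ u x, x ∈ ((R u).erase i).biUnion (fun j => blk j u c) ∪ rest u c →
          x.1.1 = u ∧ x.2 ≠ none ∨ ∃ j ∈ R u, j ≠ i ∧ ∃ w, (G j).Adj u w ∧ ((w, c), none) = x := by
        intro u x hx
        rcases mem_union.1 hx with hx | hx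
        · obtain ⟨j, hj, hx⟩ := mem_biUnion.1 hx
          rcases mem_union.1 hx with hx | hx
          · obtain ⟨w, hw, rfl⟩ := (mem_real j u c x).1 hx
            exact Or.inr ⟨j, mem_of_mem_erase hj, ne_of_mem_erase hj, w, hw.1, rfl⟩
          · obtain ⟨t, rfl⟩ := mem_dummy j u c x hx
            exact Or.inl ⟨rfl, by simp⟩
        · obtain ⟨t, rfl⟩ := mem_rest u c x hx
          exact Or.inl ⟨rfl, by simp⟩
      intro x hx
      rcases hcase u x (mem_inter.1 hx).1 with ⟨h1, h2⟩ | ⟨j, hj, hji, w, hw, rfl⟩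
      · rcases hcase u' x (mem_inter.1 hx).2 with ⟨h1', h2'⟩ | ⟨j', hj', hji', w', hw', rfl⟩
        · exact absurd (h1.symm.trans h1') hne
        · simp at h2
      · rcases hcase u' _ (mem_inter.1 hx).2 with ⟨h1', h2'⟩ | ⟨j', hj', hji', w', hw', h⟩
        · simp at h2'
        · obtain rfl : w' = w := by simpa using h
          refine mem_biUnion.2 ⟨(j, j'), mem_filter.2 ⟨mem_product.2 ⟨hj, hj'⟩, ?_⟩, ?_⟩
          · rintro (rfl : j = j')
            refine hne (card_le_one.1 (hG.card_inter j i hji) u ?_ u' ?_)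
            · exact mem_inter.2 ⟨(mem_filter.1 hj).2, hu⟩
            · exact mem_inter.2 ⟨(mem_filter.1 hj').2, hu'⟩
          · refine mem_image.2 ⟨w', mem_inter.2 ⟨?_, ?_⟩, rfl⟩
            · exact hG.mem _ _ _ hw.symm
            · exact hG.mem _ _ _ hw'.symm
    refine (card_le_card hsub).trans ?_
    refine (card_biUnion_le_card_mul _ _ 1 fun q hq => ?_).trans ?_
    · exact card_image_le.trans (hG.card_inter _ _ (mem_filter.1 hq).2)
    · rw [mul_one, sq]
      refine (card_filter_le _ _).trans ?_
      rw [card_product]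
      exact Nat.mul_le_mul (card_R u) (card_R u')

end Blockers

/-! ### Probability estimates for one random round -/

section Estimates

section Abstract

variable {I β : Type*} [Fintype I] [DecidableEq I] [DecidableEq β] {α : ℝ}

lemma one_sub_pow_le_exp (h1 : α ≤ 1) (n : ℕ) : (1 - α) ^ n ≤ Real.exp (-(α * n)) := by
  calc (1 - α) ^ n ≤ Real.exp (-α) ^ n :=
        pow_le_pow_left₀ (by linarith) (Real.one_sub_le_exp_neg α) n
    _ = Real.exp (-(α * n)) := by rw [← Real.exp_nat_mul]; ring_nf

lemma prob_forall_inactive_le (h0 : 0 ≤ α) (h1 : α ≤ 1) (W : Finset β) (M : β → Finset I)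
    {m q : ℕ} (hm : ∀ u ∈ W, m ≤ (M u).card)
    (hq : ∀ u ∈ W, ∀ u' ∈ W, u ≠ u' → (M u ∩ M u').card ≤ q) :
    prob (bernoulli I α) {ω | ∀ u ∈ W, ∀ x ∈ M u, ω x = false} ≤
      Real.exp (-(α * (W.card * (m - W.card * q)))) := by
  let B : β → Finset I := fun u => (W.erase u).biUnion fun u' => M u ∩ M u'
  have hB : ∀ u ∈ W, (B u).card ≤ W.card * q := by
    intro u hu
    refine (card_biUnion_le_card_mul _ _ q fun u' hu' => ?_).trans
      (Nat.mul_le_mul_right q (card_erase_le))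
    exact hq u hu u' (mem_of_mem_erase hu') (ne_of_mem_erase hu').symm
  have hdisj : ∀ u ∈ W, ∀ u' ∈ W, u ≠ u' → Disjoint (M u \ B u) (M u' \ B u') := by
    intro u hu u' hu' hne
    refine disjoint_left.2 fun x hx hx' => (mem_sdiff.1 hx).2 ?_
    exact mem_biUnion.2 ⟨u', mem_erase.2 ⟨hne.symm, hu'⟩,
      mem_inter.2 ⟨(mem_sdiff.1 hx).1, (mem_sdiff.1 hx').1⟩⟩
  have hset : {ω : I → Bool | ∀ u ∈ W, ∀ x ∈ M u, ω x = false} ⊆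
      {ω | ∀ x ∈ W.biUnion (fun u => M u \ B u), ω x = false} := by
    intro ω hω x hx
    obtain ⟨u, hu, hx⟩ := mem_biUnion.1 hx
    exact hω u hu x (mem_sdiff.1 hx).1
  refine (prob_mono (isWeight_bernoulli h0 h1) hset).trans ?_
  rw [prob_bernoulli_inactive]
  refine (one_sub_pow_le_exp h1 _).trans (Real.exp_le_exp.2 (neg_le_neg ?_))
  refine mul_le_mul_of_nonneg_left ?_ h0
  rw [card_biUnion hdisj]
  push_cast
  rw [← nsmul_eq_mul]
  refine card_nsmul_le_sum _ _ _ fun u hu => ?_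
  have h2 : m ≤ (M u \ B u).card + W.card * q := by
    have := le_card_sdiff (B u) (M u)
    have := hm u hu
    have := hB u hu
    omega
  have h3 : (m : ℝ) ≤ (M u \ B u).card + W.card * q := by exact_mod_cast h2
  linarith

lemma prob_forall_not_active_le (h0 : 0 ≤ α) (h1 : α ≤ 1) (W : Finset β) (a : β → I)
    (ha : Function.Injective a) (N : β → Finset I) (haN : ∀ u ∈ W, a u ∉ N u) {n k : ℕ}
    (hn : ∀ u ∈ W, (N u).card ≤ n) (hk : W.card ≤ k) :
    prob (bernoulli I α) {ω | ∀ u ∈ W, ¬ (ω (a u) = true ∧ ∀ x ∈ N u, ω x = false)} ≤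
      Real.exp (-(α * (1 - α) ^ (n + k) * W.card)) := by
  have hw := isWeight_bernoulli (I := I) h0 h1
  let T : β → Finset I := fun u => N u ∪ (W.erase u).image a
  let F : β → Set (I → Bool) := fun u => {ω | ω (a u) = true ∧ ∀ x ∈ T u, ω x = false}
  have hFd : ∀ u ∈ W, ∀ u' ∈ W, u ≠ u' → Disjoint (F u) (F u') := by
    intro u hu u' hu' hne
    refine Set.disjoint_left.2 fun ω hω hω' => ?_
    have h2 := hω.2 (a u') (mem_union_right _
      (mem_image_of_mem a (mem_erase.2 ⟨hne.symm, hu'⟩)))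
    rw [hω'.1] at h2
    exact absurd h2 (by simp)
  have hFp : ∀ u ∈ W, α * (1 - α) ^ (n + k) ≤ prob (bernoulli I α) (F u) := by
    intro u hu
    have hnot : a u ∉ T u := by
      intro h
      rcases mem_union.1 h with h | h
      · exact haN u hu h
      · obtain ⟨u', hu', h⟩ := mem_image.1 h
        exact ne_of_mem_erase hu' (ha h)
    rw [prob_bernoulli_active hnot]
    refine mul_le_mul_of_nonneg_left (pow_le_pow_of_le_one (by linarith) (by linarith) ?_) h0
    refine (card_union_le _ _).trans (add_le_add (hn u hu) ?_)
    exact card_image_le.trans (card_erase_le.trans hk)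
  have hsum := (card_nsmul_le_sum W _ _ hFp).trans (sum_prob_le_prob_biUnion hw W F hFd)
  rw [nsmul_eq_mul] at hsum
  have hsub : {ω : I → Bool | ∀ u ∈ W, ¬ (ω (a u) = true ∧ ∀ x ∈ N u, ω x = false)} ⊆
      (⋃ u ∈ W, F u)ᶜ := by
    intro ω hω hmem
    simp only [Set.mem_iUnion] at hmem
    obtain ⟨u, hu, h2, h3⟩ := hmem
    exact hω u hu ⟨h2, fun x hx => h3 x (mem_union_left _ hx)⟩
  refine (prob_mono hw hsub).trans ?_
  rw [prob_compl hw]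
  have h2 := Real.one_sub_le_exp_neg (α * (1 - α) ^ (n + k) * W.card)
  linarith

lemma prob_exists_active_le (h0 : 0 ≤ α) (h1 : α ≤ 1) (T : Finset I) :
    prob (bernoulli I α) {ω | ¬ ∀ x ∈ T, ω x = false} ≤ α * T.card := by
  have h2 : {ω : I → Bool | ¬ ∀ x ∈ T, ω x = false} = {ω | ∀ x ∈ T, ω x = false}ᶜ := by
    ext
    simp
  rw [h2, prob_compl (isWeight_bernoulli h0 h1), prob_bernoulli_inactive]
  have := one_add_mul_le_pow (a := -α) (by linarith) T.card
  rw [← sub_eq_add_neg] at this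
  linarith

end Abstract

variable {V Γ ι : Type*} [Fintype V] [DecidableEq V] [Fintype Γ] [DecidableEq Γ] [Fintype ι]
  [DecidableEq ι] {G : ι → SimpleGraph V} {S : ι → Finset V} {L : V → Finset Γ} {C D n : ℕ}
  {N : V → Γ → Finset (Item V Γ ι n)} {M : ι → V → Γ → Finset (Item V Γ ι n)} {α : ℝ}

/-- The vertex `u` receives the color `c`. -/
def Receives (N : V → Γ → Finset (Item V Γ ι n)) (ω : Item V Γ ι n → Bool) (u : V) (c : Γ) :
    Prop :=
  ω ((u, c), none) = true ∧ ∀ x ∈ N u c, ω x = false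

/-- The vertex `v` loses the color `c`. -/
def lostEvent (N : V → Γ → Finset (Item V Γ ι n)) (v : V) (c : Γ) :
    Set (Item V Γ ι n → Bool) :=
  {ω | ¬ ∀ x ∈ N v c, ω x = false}

/-- The vertex `u` receives no color other than `c`, and does not lose the color `c` because of
another graph than `G i`. -/
def surviveEvent (L : V → Finset Γ) (N : V → Γ → Finset (Item V Γ ι n))
    (M : ι → V → Γ → Finset (Item V Γ ι n)) (i : ι) (c : Γ) (u : V) :
    Set (Item V Γ ι n → Bool) :=
  {ω | (∀ c' ∈ L u, c' ≠ c → ¬ Receives N ω u c') ∧ ∀ x ∈ M i u c, ω x = false}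

lemma prob_lost_le (hN : IsBlocking G S L C D N M) (h0 : 0 ≤ α) (h1 : α ≤ 1) {v : V}
    {W : Finset Γ} (hW : W ⊆ L v) :
    prob (bernoulli _ α) (⋂ c ∈ W, lostEvent N v c) ≤ (α * (C * D)) ^ W.card := by
  rw [prob_biInter_of_disjoint (isWeight_bernoulli h0 h1) W _ (fun c => N v c)]
  · rw [← prod_const]
    refine prod_le_prod (fun c _ => prob_nonneg (isWeight_bernoulli h0 h1) _) fun c hc => ?_
    refine (prob_exists_active_le h0 h1 (N v c)).trans (mul_le_mul_of_nonneg_left ?_ h0)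
    exact_mod_cast hN.card_le v c (hW hc)
  · intro c _ x y hxy
    have := determinedBy_inactive (N v c) hxy
    simp only [Set.mem_ofPred_eq] at this
    simp only [lostEvent, Set.mem_ofPred_eq, this]
  · intro c _ c' _ hne
    refine Set.disjoint_left.2 fun x hx hx' => hne ?_
    rw [← hN.color_eq v c x hx, ← hN.color_eq v c' x hx']

lemma prob_survive_le (hN : IsBlocking G S L C D N M) (h0 : 0 ≤ α) (h1 : α ≤ 1) {i : ι} {c : Γ}
    {ℓ : ℕ} {W : Finset V} (hWS : W ⊆ S i) (hc : ∀ u ∈ W, c ∈ L u)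
    (hℓ : ∀ u ∈ W, (L u).card = ℓ) :
    prob (bernoulli _ α) (⋂ u ∈ W, surviveEvent L N M i c u) ≤
      Real.exp (-(α * ((((C - 1) * D : ℕ) : ℝ) - W.card * (C : ℝ) ^ 2) +
        α * (1 - α) ^ (C * D + W.card) * ((ℓ - 1 : ℕ) : ℝ))) ^ W.card := by
  have hw := isWeight_bernoulli (I := Item V Γ ι n) h0 h1
  let J := (W.biUnion L).erase c
  let Wc : Γ → Finset V := fun c' => W.filter fun u => c' ∈ L u
  let A : Γ → Set (Item V Γ ι n → Bool) := fun c' => {ω | ∀ u ∈ Wc c', ¬ Receives N ω u c'}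
  let B : Set (Item V Γ ι n → Bool) := {ω | ∀ u ∈ W, ∀ x ∈ M i u c, ω x = false}
  have hsub : (⋂ u ∈ W, surviveEvent L N M i c u) ⊆ B ∩ ⋂ c' ∈ J, A c' := by
    intro ω hω
    simp only [Set.mem_iInter] at hω
    refine ⟨fun u hu => (hω u hu).2, ?_⟩
    simp only [Set.mem_iInter]
    intro c' hc' u hu
    exact (hω u (mem_filter.1 hu).1).1 c' (mem_filter.1 hu).2 (ne_of_mem_erase hc')
  have hB : DeterminedBy B {x | x.1.2 = c} := by
    intro x y hxy
    simp only [B, Set.mem_ofPred_eq, eq_iff_iff]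
    refine forall₂_congr fun u _ => forall₂_congr fun z hz => ?_
    rw [hxy z (hN.color_eq u c z (hN.subset i u c hz))]
  have hA : ∀ c', DeterminedBy (A c') {x | x.1.2 = c'} := by
    intro c' x y hxy
    simp only [A, Set.mem_ofPred_eq, eq_iff_iff, Receives]
    refine forall₂_congr fun u _ => not_congr (and_congr ?_ (forall₂_congr fun z hz => ?_))
    · rw [hxy ((u, c'), none) rfl]
    · rw [hxy z (hN.color_eq u c' z hz)]
  have hAJ : DeterminedBy (⋂ c' ∈ J, A c') {x | x.1.2 ≠ c} := by
    intro x y hxy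
    simp only [Set.mem_iInter, eq_iff_iff]
    refine forall₂_congr fun c' hc' => ?_
    have := hA c' (x := x) (y := y) fun z (hz : z.1.2 = c') =>
      hxy z (fun h : z.1.2 = c => ne_of_mem_erase hc' (hz.symm.trans h))
    simpa using this
  have hBp : prob (bernoulli _ α) B ≤
      Real.exp (-(α * (W.card * ((((C - 1) * D : ℕ) : ℝ) - W.card * (C : ℝ) ^ 2)))) := by
    have := prob_forall_inactive_le h0 h1 W (fun u => M i u c)
      (fun u hu => hN.le_card i u (hWS hu) c (hc u hu))
      (fun u hu u' hu' hne => hN.card_inter i u (hWS hu) u' (hWS hu') hne c)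
    exact_mod_cast this
  have hAp : ∀ c' ∈ J, prob (bernoulli _ α) (A c') ≤
      Real.exp (-(α * (1 - α) ^ (C * D + W.card) * (Wc c').card)) := fun c' _ =>
    prob_forall_not_active_le h0 h1 (Wc c') (fun u => ((u, c'), none))
      (fun u u' h => by simpa using h) (fun u => N u c') (fun u _ => hN.self_notMem u c')
      (fun u hu => hN.card_le u c' (mem_filter.1 hu).2) (card_filter_le _ _)
  have hcount : ∑ c' ∈ J, (Wc c').card = W.card * (ℓ - 1) := by
    have h2 := sum_card_bipartiteAbove_eq_sum_card_bipartiteBelow (s := J) (t := W)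
      (fun c' u => c' ∈ L u)
    calc ∑ c' ∈ J, (Wc c').card = ∑ u ∈ W, (J.filter fun c' => c' ∈ L u).card := h2
      _ = ∑ u ∈ W, (ℓ - 1) := sum_congr rfl fun u hu => by
          rw [← hℓ u hu, ← card_erase_of_mem (hc u hu)]
          congr 1
          ext c'
          simp only [J, mem_filter, mem_erase, mem_biUnion]
          exact ⟨fun h => ⟨h.1.1, h.2⟩, fun h => ⟨⟨h.1, u, hu, h.2⟩, h.2⟩⟩
      _ = _ := by simp
  have hcount' : (∑ c' ∈ J, ((Wc c').card : ℝ)) = W.card * ((ℓ - 1 : ℕ) : ℝ) := by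
    exact_mod_cast hcount
  refine (prob_mono hw hsub).trans ?_
  rw [prob_inter_of_disjoint hw hB hAJ (Set.disjoint_left.2 fun x hx hx' => hx' hx),
    prob_biInter_of_disjoint hw J A _ (fun c' _ => hA c') fun c₁ _ c₂ _ hne =>
      Set.disjoint_left.2 fun x (hx : x.1.2 = c₁) (hx' : x.1.2 = c₂) => hne (hx.symm.trans hx')]
  refine (mul_le_mul hBp (prod_le_prod (fun c' _ => prob_nonneg hw _) hAp)
    (prod_nonneg fun c' _ => prob_nonneg hw _) (Real.exp_pos _).le).trans_eq ?_
  rw [← Real.exp_sum, ← Real.exp_add, ← Real.exp_nat_mul, sum_neg_distrib, ← mul_sum, hcount']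
  congr 1
  ring

end Estimates

/-! ### One random round -/

section Round

variable {V Γ ι : Type*} [Fintype V] [DecidableEq V] [Fintype Γ] [DecidableEq Γ] [Fintype ι]
  [DecidableEq ι] {G : ι → SimpleGraph V} {S : ι → Finset V} {L : V → Finset Γ} {C D ℓ n : ℕ}
  {N : V → Γ → Finset (Item V Γ ι n)} {M : ι → V → Γ → Finset (Item V Γ ι n)} {α : ℝ}

open Classical in
lemma determinedBy_le_card_filter {I Ω β : Type*} (U : Finset β) (E : β → Set (I → Ω))
    {T : Set I} (hE : ∀ u ∈ U, DeterminedBy (E u) T) (t : ℕ) :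
    DeterminedBy {ω | t ≤ (U.filter fun u => ω ∈ E u).card} T := by
  intro x y hxy
  have : (U.filter fun u => x ∈ E u) = U.filter fun u => y ∈ E u :=
    filter_congr fun u hu => iff_of_eq (hE u hu hxy)
  simp only [Set.mem_ofPred_eq, this]

open Classical in
/-- The colors that `u` retains after the round `ω`; there are none if `u` receives a color. -/
noncomputable def residualList (L : V → Finset Γ) (N : V → Γ → Finset (Item V Γ ι n))
    (ω : Item V Γ ι n → Bool) (u : V) : Finset Γ :=
  if ∃ c ∈ L u, Receives N ω u c then ∅ else (L u).filter fun c => ω ∉ lostEvent N u c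

omit [Fintype V] [Fintype Γ] [Fintype ι] in
lemma hasListColoring_of_residualList (hN : IsBlocking G S L C D N M)
    (ω : Item V Γ ι n → Bool)
    (hne : ∀ u, (L u).Nonempty → (¬ ∃ c ∈ L u, Receives N ω u c) →
      (residualList L N ω u).Nonempty)
    (h : HasListColoring G (residualList L N ω)) : HasListColoring G L := by
  classical
  obtain ⟨ψ, hψ, hψG⟩ := h
  let φ : V → Γ := fun u => if hu : ∃ c ∈ L u, Receives N ω u c then hu.choose else ψ u
  have hφ1 : ∀ u, (∃ c ∈ L u, Receives N ω u c) → φ u ∈ L u ∧ Receives N ω u (φ u) := by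
    intro u hu
    simp only [φ, dif_pos hu]
    exact hu.choose_spec
  have hφ2 : ∀ u, (L u).Nonempty → (¬ ∃ c ∈ L u, Receives N ω u c) →
      φ u = ψ u ∧ φ u ∈ L u ∧ ω ∉ lostEvent N u (φ u) := by
    intro u hu hu'
    have h1 := hψ u (hne u hu hu')
    simp only [φ, dif_neg hu']
    rw [residualList, if_neg hu', mem_filter] at h1
    exact ⟨trivial, h1⟩
  have hmem : ∀ u, (L u).Nonempty → φ u ∈ L u := by
    intro u hu
    by_cases h : ∃ c ∈ L u, Receives N ω u c
    · exact (hφ1 u h).1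
    · exact (hφ2 u hu h).2.1
  have hinact : ∀ u, (L u).Nonempty → ∀ x ∈ N u (φ u), ω x = false := by
    intro u hu
    by_cases h : ∃ c ∈ L u, Receives N ω u c
    · exact (hφ1 u h).2.2
    · simpa [lostEvent] using (hφ2 u hu h).2.2
  have hleft : ∀ i u v, (G i).Adj u v → (L u).Nonempty → (L v).Nonempty →
      (∃ c ∈ L u, Receives N ω u c) → φ u ≠ φ v := by
    intro i u v huv hu hv h heq
    have h1 := (hφ1 u h).2.1
    have h2 := hinact v hv _ (hN.mem_of_adj i v u (φ v) huv.symm (heq ▸ hmem u hu))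
    rw [← heq, h1] at h2
    exact absurd h2 (by simp)
  refine ⟨φ, hmem, fun i u v huv hu hv => ?_⟩
  by_cases h : ∃ c ∈ L u, Receives N ω u c
  · exact hleft i u v huv hu hv h
  by_cases h' : ∃ c ∈ L v, Receives N ω v c
  · exact (hleft i v u huv.symm hv hu h').symm
  rw [(hφ2 u hu h).1, (hφ2 v hv h').1]
  exact hψG i u v huv (hne u hu h) (hne v hv h')

/-- The upper bound for the probability that a neighbor remains relevant in a round. -/
noncomputable def surviveProb (α : ℝ) (C D ℓ k : ℕ) : ℝ :=
  Real.exp (-(α * ((((C - 1) * D : ℕ) : ℝ) - k * (C : ℝ) ^ 2) +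
    α * (1 - α) ^ (C * D + k) * ((ℓ - 1 : ℕ) : ℝ)))

open Classical in
lemma exists_round (hG : IsNearlyDisjoint G S C) (hD : ColorDegreeLE G L D)
    (hL : ∀ v, L v = ∅ ∨ (L v).card = ℓ) (hN : IsBlocking G S L C D N M)
    (h0 : 0 ≤ α) (h1 : α ≤ 1) {k t₁ t₂ : ℕ} {p : ℝ} (hp : 0 ≤ p) (hk₁ : k ≤ t₁) (hk₂ : k ≤ t₂)
    (hp₁ : (ℓ * (α * (C * D))) ^ k ≤ p * ((t₁ + 1 - k : ℕ) : ℝ) ^ k)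
    (hp₂ : (D * surviveProb α C D ℓ k) ^ k ≤ p * ((t₂ + 1 - k : ℕ) : ℝ) ^ k)
    (hp₃ : 4 * p * ((((D + 1) * (ℓ * (C * D + 1)) : ℕ) : ℝ) *
      (((C * D + 1) * (1 + C * (ℓ * D)) : ℕ) : ℝ) + 1) ≤ 1) :
    ∃ ω : Item V Γ ι n → Bool,
      (∀ v, ((L v).filter fun c => ω ∈ lostEvent N v c).card < t₁) ∧
      ∀ i v, ∀ c ∈ L v,
        ((colorNbrs (G i) L v c).filter fun u => ω ∈ surviveEvent L N M i c u).card < t₂ := by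
  have hw := isWeight_bernoulli (I := Item V Γ ι n) h0 h1
  have hLle : ∀ v, (L v).card ≤ ℓ := fun v => by rcases hL v with h | h <;> simp [h]
  let K : Finset (V ⊕ ι × V × Γ) := univ.filter fun
    | .inl _ => True
    | .inr (_, v, c) => c ∈ L v
  let E : V ⊕ ι × V × Γ → Set (Item V Γ ι n → Bool) := fun
    | .inl v => {ω | t₁ ≤ ((L v).filter fun c => ω ∈ lostEvent N v c).card}
    | .inr (i, v, c) =>
      {ω | t₂ ≤ ((colorNbrs (G i) L v c).filter fun u => ω ∈ surviveEvent L N M i c u).card}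
  let T : V ⊕ ι × V × Γ → Finset (Item V Γ ι n) := fun
    | .inl v => (L v).biUnion (N v)
    | .inr (i, v, c) => (colorNbrs (G i) L v c).biUnion fun u =>
        (L u).biUnion fun c' => insert ((u, c'), none) (N u c')
  have key : ∃ ω, ∀ e ∈ K, ω ∉ E e := by
    refine exists_forall_notMem hw K E T ?_ (s := (D + 1) * (ℓ * (C * D + 1)))
      (r := (C * D + 1) * (1 + C * (ℓ * D))) ?_ ?_ (p := p) ?_ hp hp₃
    · rintro (v | ⟨i, v, c⟩) -
      · refine determinedBy_le_card_filter _ _ (fun c hc x y hxy => ?_) _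
        have := determinedBy_inactive (N v c) (x := x) (y := y) fun z hz =>
          hxy z (mem_coe.2 (mem_biUnion.2 ⟨c, hc, hz⟩))
        simp only [Set.mem_ofPred_eq] at this
        simp only [lostEvent, Set.mem_ofPred_eq, this]
      · refine determinedBy_le_card_filter _ _ (fun u hu x y hxy => ?_) _
        have hxy' : ∀ c' ∈ L u, ∀ z ∈ insert ((u, c'), none) (N u c'), x z = y z :=
          fun c' hc' z hz => hxy z (mem_coe.2
            (mem_biUnion.2 ⟨u, hu, mem_biUnion.2 ⟨c', hc', hz⟩⟩))
        simp only [surviveEvent, Set.mem_ofPred_eq, eq_iff_iff, Receives]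
        refine and_congr (forall₂_congr fun c' hc' => imp_congr_right fun _ => not_congr
          (and_congr ?_ (forall₂_congr fun z hz => ?_))) (forall₂_congr fun z hz => ?_)
        · rw [hxy' c' hc' _ (mem_insert_self _ _)]
        · rw [hxy' c' hc' z (mem_insert_of_mem hz)]
        · rw [hxy' c (mem_colorNbrs.1 hu).2 z (mem_insert_of_mem (hN.subset i u c hz))]
    · have hone : ∀ v, ((L v).biUnion fun c => insert ((v, c), none) (N v c)).card ≤
          ℓ * (C * D + 1) := fun v =>
        (card_biUnion_le_card_mul _ _ (C * D + 1) fun c hc => (card_insert_le _ _).trans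
          (Nat.add_le_add_right (hN.card_le v c hc) 1)).trans (Nat.mul_le_mul_right _ (hLle v))
      rintro (v | ⟨i, v, c⟩) he
      · refine (card_le_card ?_).trans ((hone v).trans (Nat.le_mul_of_pos_left _ (by omega)))
        exact biUnion_mono fun c _ => subset_insert _ _
      · have hc : c ∈ L v := (mem_filter.1 he).2
        exact (card_biUnion_le_card_mul _ _ _ fun u _ => hone u).trans
          (Nat.mul_le_mul_right _ ((hD i v c hc).trans (by omega)))
    · rintro ⟨⟨w, d⟩, o⟩
      let Z : Finset V := insert w (if d ∈ L w then allNbrs G L w d else ∅)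
      have hZ : Z.card ≤ C * D + 1 := by
        refine (card_insert_le _ _).trans (Nat.add_le_add_right ?_ 1)
        split_ifs with h
        · exact card_allNbrs_le hG hD h
        · simp
      have hmemZ : ∀ u, ∀ c ∈ L u, ((w, d), o) ∈ N u c → u ∈ Z := by
        intro u c hc hx
        obtain rfl : d = c := hN.color_eq u c _ hx
        rcases hN.eq_or_adj u d _ hx with h | ⟨i, hi, hd⟩
        · exact mem_insert.2 (Or.inl h.symm)
        · refine mem_insert_of_mem ?_
          rw [if_pos hd]
          exact mem_allNbrs.2 ⟨i, hi.symm, hc⟩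
      refine ⟨Z.biUnion fun u => insert (Sum.inl u) ((univ.filter fun i => u ∈ S i).biUnion fun i =>
        (L u).biUnion fun c => (colorNbrs (G i) L u c).image fun v => Sum.inr (i, v, c)), ?_, ?_⟩
      · refine (card_biUnion_le_card_mul _ _ (1 + C * (ℓ * D)) fun u _ => ?_).trans
          (Nat.mul_le_mul_right _ hZ)
        rw [add_comm]
        refine (card_insert_le _ _).trans (Nat.add_le_add_right ?_ 1)
        refine (card_biUnion_le_card_mul _ _ (ℓ * D) fun i _ => ?_).trans
          (Nat.mul_le_mul_right _ (hG.card_filter u))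
        exact (card_biUnion_le_card_mul _ _ D fun c hc => card_image_le.trans (hD i u c hc)).trans
          (Nat.mul_le_mul_right _ (hLle u))
      · rintro (v | ⟨i, v, c⟩) he hx
        · obtain ⟨c, hc, hx⟩ := mem_biUnion.1 hx
          exact mem_biUnion.2 ⟨v, hmemZ v c hc hx, mem_insert_self _ _⟩
        · have hc : c ∈ L v := (mem_filter.1 he).2
          obtain ⟨u, hu, hx⟩ := mem_biUnion.1 hx
          obtain ⟨c', hc', hx⟩ := mem_biUnion.1 hx
          obtain ⟨huv, hcu⟩ := mem_colorNbrs.1 hu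
          have huZ : u ∈ Z := by
            rcases mem_insert.1 hx with h | h
            · simp only [Prod.mk.injEq] at h
              exact mem_insert.2 (Or.inl h.1.1.symm)
            · exact hmemZ u c' hc' h
          refine mem_biUnion.2 ⟨u, huZ, mem_insert_of_mem (mem_biUnion.2 ⟨i, ?_,
            mem_biUnion.2 ⟨c, hcu, mem_image.2 ⟨v, mem_colorNbrs.2 ⟨huv.symm, hc⟩, rfl⟩⟩⟩)⟩
          exact mem_filter.2 ⟨mem_univ i, hG.mem i u v huv.symm⟩
    · rintro (v | ⟨i, v, c⟩) he
      · have h2 := prob_le_card_mul_pow_le hw (L v) (lostEvent N v) (n := ℓ) (k := k) (t := t₁)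
          (s := α * (C * D)) (by positivity) (hLle v) fun W hW hWk =>
            hWk ▸ prob_lost_le hN h0 h1 hW
        exact le_of_mul_le_mul_right (h2.trans hp₁) (pow_pos (by norm_cast; omega) k)
      · have hc : c ∈ L v := (mem_filter.1 he).2
        have h2 := prob_le_card_mul_pow_le hw (colorNbrs (G i) L v c) (surviveEvent L N M i c)
          (n := D) (k := k) (t := t₂) (s := surviveProb α C D ℓ k) (Real.exp_pos _).le
          (hD i v c hc) fun W hW hWk => by
            subst hWk
            refine prob_survive_le hN h0 h1 (fun u hu => ?_) (fun u hu => ?_) fun u hu => ?_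
            · exact hG.mem i u v (mem_colorNbrs.1 (hW hu)).1.symm
            · exact (mem_colorNbrs.1 (hW hu)).2
            · refine (hL u).resolve_left fun h => ?_
              have := (mem_colorNbrs.1 (hW hu)).2
              simp [h] at this
        exact le_of_mul_le_mul_right (h2.trans hp₂) (pow_pos (by norm_cast; omega) k)
  obtain ⟨ω, hω⟩ := key
  refine ⟨ω, fun v => ?_, fun i v c hc => ?_⟩
  · have := hω (Sum.inl v) (mem_filter.2 ⟨mem_univ _, trivial⟩)
    simpa [E] using this
  · have := hω (Sum.inr (i, v, c)) (mem_filter.2 ⟨mem_univ _, hc⟩)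
    simpa [E] using this

/-- One round reduces the list coloring problem to one with shorter lists and smaller color
degrees. -/
theorem exists_reduction (hG : IsNearlyDisjoint G S C) (hD : ColorDegreeLE G L D)
    (hL : ∀ v, L v = ∅ ∨ (L v).card = ℓ)
    (h0 : 0 ≤ α) (h1 : α ≤ 1) {k t₁ t₂ : ℕ} {p : ℝ} (hp : 0 ≤ p) (hk₁ : k ≤ t₁) (hk₂ : k ≤ t₂)
    (ht₁ : t₁ ≤ ℓ)
    (hp₁ : (ℓ * (α * (C * D))) ^ k ≤ p * ((t₁ + 1 - k : ℕ) : ℝ) ^ k)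
    (hp₂ : (D * surviveProb α C D ℓ k) ^ k ≤ p * ((t₂ + 1 - k : ℕ) : ℝ) ^ k)
    (hp₃ : 4 * p * ((((D + 1) * (ℓ * (C * D + 1)) : ℕ) : ℝ) *
      (((C * D + 1) * (1 + C * (ℓ * D)) : ℕ) : ℝ) + 1) ≤ 1) :
    ∃ L' : V → Finset Γ, ColorDegreeLE G L' t₂ ∧ (∀ v, L' v = ∅ ∨ ℓ - t₁ ≤ (L' v).card) ∧
      (HasListColoring G L' → HasListColoring G L) := by
  classical
  obtain ⟨N, M, hN⟩ := exists_isBlocking hG hD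
  obtain ⟨ω, hω₁, hω₂⟩ := exists_round hG hD hL hN h0 h1 hp hk₁ hk₂ hp₁ hp₂ hp₃
  have hcard : ∀ u, (L u).Nonempty → (¬ ∃ c ∈ L u, Receives N ω u c) →
      ℓ - t₁ < (residualList L N ω u).card := by
    intro u hu hu'
    have h2 := (hL u).resolve_left hu.ne_empty
    have h3 := card_filter_add_card_filter_not (s := L u) (fun c => ω ∈ lostEvent N u c)
    have h4 := hω₁ u
    rw [residualList, if_neg hu']
    omega
  refine ⟨residualList L N ω, fun i v c hc => ?_, fun v => ?_, fun h =>
    hasListColoring_of_residualList hN ω (fun u hu hu' => card_pos.1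
      ((Nat.zero_le _).trans_lt (hcard u hu hu'))) h⟩
  · have hcv : c ∈ L v := by
      unfold residualList at hc
      split_ifs at hc with h
      · simp at hc
      · exact (mem_filter.1 hc).1
    refine (card_le_card fun u hu => ?_).trans (hω₂ i v c hcv).le
    obtain ⟨huv, hcu⟩ := mem_colorNbrs.1 hu
    unfold residualList at hcu
    split_ifs at hcu with h
    · simp at hcu
    · obtain ⟨hcu, hlost⟩ := mem_filter.1 hcu
      refine mem_filter.2 ⟨mem_colorNbrs.2 ⟨huv, hcu⟩, fun c' hc' _ hr => h ⟨c', hc', hr⟩, ?_⟩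
      simp only [lostEvent, Set.mem_ofPred_eq, not_not] at hlost
      exact fun x hx => hlost x (hN.subset i u c hx)
  · by_cases h : ∃ c ∈ L v, Receives N ω v c
    · exact Or.inl (by rw [residualList, if_pos h])
    · rcases (L v).eq_empty_or_nonempty with he | hne
      · exact Or.inl (by rw [residualList, if_neg h, he, filter_empty])
      · exact Or.inr (hcard v hne h).le

end Round

/-! ### Choice of parameters -/

section Parameters

open Filter

lemma eventually_mul_pow_mul_inv_pow_floor_le_one (K : ℝ) (hK : 0 ≤ K) (m : ℕ) {η : ℝ}
    (hη : 0 < η) :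
    ∀ᶠ D : ℕ in atTop, K * (D : ℝ) ^ m * ((1 + η)⁻¹) ^ ⌊η * D⌋₊ ≤ 1 := by
  have hb : (1 : ℝ) < 1 + η := by linarith
  have hr : (1 + η) ^ (-η) < 1 := Real.rpow_lt_one_of_one_lt_of_neg hb (by linarith)
  have h := (tendsto_pow_const_mul_const_pow_of_lt_one m
    (Real.rpow_nonneg (zero_le_one.trans hb.le) (-η)) hr).const_mul (K * (1 + η))
  rw [mul_zero] at h
  filter_upwards [h.eventually_le_const one_pos] with D hD
  refine le_trans ?_ hD
  have h1 : ((1 + η)⁻¹) ^ ⌊η * D⌋₊ ≤ (1 + η) * ((1 + η) ^ (-η)) ^ D := by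
    rw [inv_pow, ← Real.rpow_natCast, ← Real.rpow_neg (by linarith), ← Real.rpow_natCast _ D,
      ← Real.rpow_mul (by linarith)]
    calc (1 + η) ^ (-(⌊η * D⌋₊ : ℝ)) ≤ (1 + η) ^ (1 + -η * D) :=
          Real.rpow_le_rpow_of_exponent_le hb.le (by linarith [(Nat.lt_floor_add_one (η * D)).le])
      _ = _ := by rw [Real.rpow_add (by linarith), Real.rpow_one]
  calc K * (D : ℝ) ^ m * ((1 + η)⁻¹) ^ ⌊η * D⌋₊
      ≤ K * (D : ℝ) ^ m * ((1 + η) * ((1 + η) ^ (-η)) ^ D) := by gcongr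
    _ = _ := by ring

lemma surviveProb_le {C D ℓ k : ℕ} {ε a η : ℝ} (hC : 1 ≤ C) (hε : 0 < ε) (hε1 : ε ≤ 1)
    (ha : a = ε / (64 * (C + 1) ^ 2)) (hη : η = a * ε / 100) (hD : 1 ≤ η * D)
    (hℓ : (1 + ε) * D ≤ ℓ) (hk : k ≤ η * D) :
    surviveProb (a / D) C D ℓ k ≤ Real.exp (-(a * (C + ε / 4))) := by
  have hC' : (1 : ℝ) ≤ C := by exact_mod_cast hC
  have ha0 : 0 < a := by rw [ha]; positivity
  have haC : a * (C + 1) ^ 2 = ε / 64 := by rw [ha]; field_simp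
  have haC1 : a * (C + 1) ≤ ε / 64 := by nlinarith
  have hη0 : 0 < η := by rw [hη]; positivity
  have hηC : η * C ^ 2 ≤ ε / 6400 := by rw [hη]; nlinarith [mul_nonneg ha0.le hε.le]
  have hη1 : η ≤ ε / 6400 := by nlinarith
  have hD0 : (0 : ℝ) < D := by
    by_contra h
    nlinarith [(Nat.cast_nonneg D : (0 : ℝ) ≤ D)]
  have hD1 : (1 : ℝ) ≤ D := by exact_mod_cast hD0
  have hℓ1 : 1 ≤ ℓ := by
    have : (0 : ℝ) < ℓ := by nlinarith
    exact_mod_cast this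
  have h1 : a / D * k ≤ a * η := by
    rw [div_mul_eq_mul_div, div_le_iff₀ hD0]
    nlinarith
  have h2 : 1 - a * (C + η) ≤ (1 - a / D) ^ (C * D + k) := by
    have := one_add_mul_le_pow (a := -(a / D)) (by
      have : a / D ≤ 1 := by rw [div_le_one hD0]; nlinarith
      linarith) (C * D + k)
    rw [← sub_eq_add_neg] at this
    refine le_trans ?_ this
    push_cast
    have h3 : a / D * D = a := by field_simp
    nlinarith
  have h3 : a * (1 + ε - η) ≤ a / D * ((ℓ - 1 : ℕ) : ℝ) := by
    rw [div_mul_eq_mul_div, le_div_iff₀ hD0, mul_assoc, Nat.cast_sub hℓ1, Nat.cast_one]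
    gcongr
    nlinarith
  have h4 : a * (C - 1) = a / D * (((C - 1) * D : ℕ) : ℝ) := by
    push_cast [Nat.cast_sub hC]
    field_simp
  have haη : a * (C + η) ≤ ε / 64 := by nlinarith
  have h5 : a * (1 + ε - η) * (1 - a * (C + η)) ≤
      a / D * (1 - a / D) ^ (C * D + k) * ((ℓ - 1 : ℕ) : ℝ) := by
    calc a * (1 + ε - η) * (1 - a * (C + η))
        ≤ (a / D * ((ℓ - 1 : ℕ) : ℝ)) * (1 - a / D) ^ (C * D + k) := by
          gcongr
          linarith
      _ = _ := by ring
  unfold surviveProb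
  rw [Real.exp_le_exp, neg_le_neg_iff]
  have h6 : a * (C + ε / 4) ≤
      a * (C - 1) - a * η * C ^ 2 + a * (1 + ε - η) * (1 - a * (C + η)) := by
    have : C + ε / 4 ≤ (C - 1) - η * C ^ 2 + (1 + ε - η) * (1 - a * (C + η)) := by
      nlinarith [mul_nonneg ha0.le (by linarith : (0 : ℝ) ≤ C + η)]
    calc _ ≤ a * ((C - 1) - η * C ^ 2 + (1 + ε - η) * (1 - a * (C + η))) := by gcongr
      _ = _ := by ring
  have h7 : a / D * k * (C : ℝ) ^ 2 ≤ a * η * C ^ 2 := by gcongr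
  rw [mul_sub, ← h4]
  linarith [mul_assoc (a / D) (k : ℝ) ((C : ℝ) ^ 2)]

lemma four_mul_poly_le {C D ℓ : ℕ} {lam : ℝ} (hD : 1 ≤ D) (hℓ : (ℓ : ℝ) ≤ (lam + 1) * D) :
    4 * ((((D + 1) * (ℓ * (C * D + 1)) : ℕ) : ℝ) * (((C * D + 1) * (1 + C * (ℓ * D)) : ℕ) : ℝ) + 1)
      ≤ 4 * (2 * (lam + 1) * (C + 1) ^ 2 * (C * (lam + 1) + 1) + 1) * (D : ℝ) ^ 6 := by
  have hD1 : (1 : ℝ) ≤ D := by exact_mod_cast hD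
  have hlam : 0 ≤ lam + 1 := by
    by_contra! h
    nlinarith [(Nat.cast_nonneg ℓ : (0 : ℝ) ≤ ℓ)]
  push_cast
  have h1 : (D + 1 : ℝ) ≤ 2 * D := by linarith
  have h2 : (C * D + 1 : ℝ) ≤ (C + 1) * D := by linarith
  have h3 : (1 + C * (ℓ * D) : ℝ) ≤ (C * (lam + 1) + 1) * D ^ 2 := by
    have h4 : (C * (ℓ * D) : ℝ) ≤ C * ((lam + 1) * D * D) := by gcongr
    nlinarith [one_le_pow₀ hD1 (n := 2)]
  have h5 : ((D + 1) * (ℓ * (C * D + 1)) * ((C * D + 1) * (1 + C * (ℓ * D))) : ℝ) ≤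
      (2 * D) * (((lam + 1) * D) * ((C + 1) * D)) *
        (((C + 1) * D) * ((C * (lam + 1) + 1) * D ^ 2)) := by gcongr
  have h6 := one_le_pow₀ hD1 (n := 6)
  linear_combination 4 * h5 + 4 * h6

lemma exp_neg_le_quadratic {y : ℝ} (h0 : 0 ≤ y) (h1 : y ≤ 1) :
    Real.exp (-y) ≤ 1 - y + y ^ 2 := by
  have := Real.abs_exp_sub_one_sub_id_le (x := -y) (by rwa [abs_neg, abs_of_nonneg h0])
  rw [neg_sq] at this
  linarith [(abs_le.1 this).2]

lemma exp_neg_gap {C : ℕ} {ε a η : ℝ} (hε : 0 < ε) (hε1 : ε ≤ 1)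
    (ha : a = ε / (64 * (C + 1) ^ 2)) (hη : η = a * ε / 100) :
    (1 + η) * ((1 + η) * Real.exp (-(a * (C + ε / 4))) + 2 * η) ≤
      1 - (1 + η) * (a * C) - 2 * η := by
  have hC' : (0 : ℝ) ≤ C := Nat.cast_nonneg C
  have ha0 : 0 < a := by rw [ha]; positivity
  have haC : a * (C + 1) ^ 2 = ε / 64 := by rw [ha]; field_simp
  have haC1 : a * (C + 1) ≤ 1 / 64 := by nlinarith
  have hη0 : 0 < η := by rw [hη]; positivity
  have hη1 : η ≤ 1 / 6400 := by nlinarith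
  set s := Real.exp (-(a * (C + ε / 4)))
  have hs1 : s ≤ 1 - a * C - a * ε * (15 / 64) := by
    have h := exp_neg_le_quadratic (y := a * (C + ε / 4)) (by positivity) (by nlinarith)
    have h2 : (a * (C + ε / 4)) ^ 2 ≤ a * (ε / 64) := by
      rw [← haC, mul_pow, sq a, mul_assoc]
      gcongr
      linarith
    linarith
  have h1 : s ≤ 1 := by nlinarith [mul_pos ha0 hε]
  have h2 : (1 + η) * ((1 + η) * s + 2 * η) ≤ s + 5 * η := by
    have h3 : (2 * η + η ^ 2) * s ≤ 2 * η + η ^ 2 := mul_le_of_le_one_right (by positivity) h1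
    have h4 : η ^ 2 ≤ η * (1 / 6400) := by rw [sq]; gcongr
    linarith
  have h3 : η * (a * C) ≤ η := mul_le_of_le_one_right hη0.le (by nlinarith)
  nlinarith

lemma mul_add_le_sub_add {lam η s b d l u₁ u₂ k : ℝ} (hlam : 1 ≤ lam) (hη : 0 < η)
    (hb : (1 + η) * b ≤ 1) (hd0 : 0 ≤ d) (hd : 1 ≤ η * d) (hl : lam * d ≤ l)
    (hu₁ : u₁ ≤ (1 + η) * (b * l) + 1) (hu₂ : u₂ ≤ (1 + η) * (s * d) + 1) (hk : k ≤ η * d)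
    (hgap : (1 + η) * ((1 + η) * s + 2 * η) ≤ 1 - (1 + η) * b - 2 * η) :
    lam * (1 + η) * (u₂ + k) ≤ l - (u₁ + k) := by
  have h1 : u₂ + k ≤ ((1 + η) * s + 2 * η) * d := by linarith
  have h2 : lam * d * (1 - (1 + η) * b) ≤ l * (1 - (1 + η) * b) :=
    mul_le_mul_of_nonneg_right hl (by linarith)
  have h3 : 2 * (η * d) ≤ lam * (2 * (η * d)) :=
    le_mul_of_one_le_left (by positivity) hlam
  have h4 : lam * d * ((1 + η) * ((1 + η) * s + 2 * η)) ≤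
      lam * d * (1 - (1 + η) * b - 2 * η) := mul_le_mul_of_nonneg_left hgap (by positivity)
  have h5 : lam * (1 + η) * (u₂ + k) ≤ lam * (1 + η) * (((1 + η) * s + 2 * η) * d) :=
    mul_le_mul_of_nonneg_left h1 (by positivity)
  linarith

/-- For large `D` there are parameters to which `exists_reduction` applies, and which increase the
ratio of list sizes and color degrees by a factor `1 + η`. -/
lemma eventually_exists_parameters {C : ℕ} {ε lam a η : ℝ} (hC : 1 ≤ C) (hε : 0 < ε) (hε1 : ε ≤ 1)
    (hlam : 1 + ε ≤ lam) (ha : a = ε / (64 * (C + 1) ^ 2)) (hη : η = a * ε / 100) (D₁ : ℕ) :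
    ∀ᶠ D : ℕ in atTop, ∃ (α p : ℝ) (k t₁ t₂ : ℕ), 0 ≤ α ∧ α ≤ 1 ∧ 0 ≤ p ∧ k ≤ t₁ ∧ k ≤ t₂ ∧
      t₁ ≤ ⌈lam * D⌉₊ ∧
      (⌈lam * D⌉₊ * (α * (C * D))) ^ k ≤ p * ((t₁ + 1 - k : ℕ) : ℝ) ^ k ∧
      (D * surviveProb α C D ⌈lam * D⌉₊ k) ^ k ≤ p * ((t₂ + 1 - k : ℕ) : ℝ) ^ k ∧
      4 * p * ((((D + 1) * (⌈lam * D⌉₊ * (C * D + 1)) : ℕ) : ℝ) *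
        (((C * D + 1) * (1 + C * (⌈lam * D⌉₊ * D)) : ℕ) : ℝ) + 1) ≤ 1 ∧
      D₁ ≤ t₂ ∧ lam * (1 + η) * t₂ ≤ ((⌈lam * D⌉₊ - t₁ : ℕ) : ℝ) := by
  have hC' : (1 : ℝ) ≤ C := by exact_mod_cast hC
  have ha0 : 0 < a := by rw [ha]; positivity
  have haC : a * (C + 1) ^ 2 = ε / 64 := by rw [ha]; field_simp
  have haC1 : a * (C + 1) ≤ 1 / 64 := by nlinarith
  have hη0 : 0 < η := by rw [hη]; positivity
  have hη1 : η ≤ 1 / 6400 := by nlinarith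
  set s := Real.exp (-(a * (C + ε / 4)))
  have hs0 : 0 < s := Real.exp_pos _
  have hgap : (1 + η) * ((1 + η) * s + 2 * η) ≤ 1 - (1 + η) * (a * C) - 2 * η :=
    exp_neg_gap hε hε1 ha hη
  have hb : (1 + η) * (a * C) ≤ 1 := by
    have : 0 ≤ (1 + η) * ((1 + η) * s + 2 * η) := by positivity
    linarith
  have hbig : ∀ B : ℝ, ∀ᶠ D : ℕ in atTop, B ≤ D := fun B =>
    tendsto_natCast_atTop_atTop.eventually_ge_atTop B
  filter_upwards [hbig (1 / η), hbig (D₁ / s), eventually_ge_atTop 1,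
    eventually_mul_pow_mul_inv_pow_floor_le_one
      (4 * (2 * (lam + 1) * (C + 1) ^ 2 * (C * (lam + 1) + 1) + 1))
      (by have : 0 ≤ lam + 1 := by linarith
          positivity) 6 hη0] with D hDη hDs hD1 hDp
  rw [div_le_iff₀' hη0] at hDη
  rw [div_le_iff₀' hs0] at hDs
  have hDr : (1 : ℝ) ≤ D := by exact_mod_cast hD1
  set ℓ := ⌈lam * D⌉₊
  set k := ⌊η * D⌋₊
  have hℓ1 : lam * D ≤ ℓ := Nat.le_ceil _
  have hℓ2 : (ℓ : ℝ) ≤ (lam + 1) * D := by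
    have := (Nat.ceil_lt_add_one (show 0 ≤ lam * D by nlinarith)).le
    linarith
  have hkη : (k : ℝ) ≤ η * D := Nat.floor_le (by positivity)
  have hDℓ : (D : ℝ) ≤ ℓ := by nlinarith
  set u₁ := ⌈(1 + η) * (a * C * ℓ)⌉₊
  set u₂ := ⌈(1 + η) * (s * D)⌉₊
  have hu₁l : (1 + η) * (a * C * ℓ) ≤ u₁ := Nat.le_ceil _
  have hu₂l : (1 + η) * (s * D) ≤ u₂ := Nat.le_ceil _
  have hu₁u : (u₁ : ℝ) ≤ (1 + η) * (a * C * ℓ) + 1 := (Nat.ceil_lt_add_one (by positivity)).le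
  have hu₂u : (u₂ : ℝ) ≤ (1 + η) * (s * D) + 1 := (Nat.ceil_lt_add_one (by positivity)).le
  have ht₁ : u₁ + k ≤ ℓ := by
    have h1 : a * C * ℓ ≤ 1 / 64 * ℓ := by gcongr; nlinarith
    have h2 : (1 + η) * (a * C * ℓ) ≤ 2 * (1 / 64 * ℓ) := by gcongr; linarith
    have h3 : η * D ≤ 1 / 6400 * ℓ := by gcongr
    have : ((u₁ + k : ℕ) : ℝ) ≤ ℓ := by push_cast; linarith
    exact_mod_cast this
  have hsub : ∀ u : ℕ, u + k + 1 - k = u + 1 := fun u => by omega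
  refine ⟨a / D, ((1 + η)⁻¹) ^ k, k, u₁ + k, u₂ + k, by positivity, ?_, by positivity,
    Nat.le_add_left _ _, Nat.le_add_left _ _, ht₁, ?_, ?_, ?_, ?_, ?_⟩
  · rw [div_le_one (by positivity)]
    nlinarith
  · rw [hsub, ← mul_pow]
    refine pow_le_pow_left₀ (by positivity) ?_ k
    rw [le_inv_mul_iff₀ (by positivity), show (ℓ : ℝ) * (a / D * (C * D)) = a * C * ℓ by field_simp]
    push_cast
    linarith
  · rw [hsub, ← mul_pow]
    refine pow_le_pow_left₀ (mul_nonneg (by positivity) (Real.exp_pos _).le) ?_ k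
    have hsurv := surviveProb_le (ℓ := ℓ) hC hε hε1 ha hη hDη
      ((mul_le_mul_of_nonneg_right hlam (Nat.cast_nonneg D)).trans hℓ1) hkη
    rw [le_inv_mul_iff₀ (by positivity)]
    rw [Nat.cast_add_one]
    calc (1 + η) * (D * surviveProb (a / D) C D ℓ k) ≤ (1 + η) * (D * s) := by gcongr
      _ ≤ u₂ + 1 := by linarith
  · have h := four_mul_poly_le (C := C) hD1 hℓ2
    refine le_trans ?_ hDp
    rw [mul_right_comm]
    gcongr
  · have : (D₁ : ℝ) ≤ ((u₂ + k : ℕ) : ℝ) := by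
      push_cast
      nlinarith [mul_pos hη0 (mul_pos hs0 (zero_lt_one.trans_le hDr)),
        (Nat.cast_nonneg k : (0 : ℝ) ≤ k)]
    exact_mod_cast this
  · rw [Nat.cast_sub ht₁]
    push_cast
    exact mul_add_le_sub_add (by linarith) hη0 hb (Nat.cast_nonneg D) hDη hℓ1 hu₁u hu₂u hkη
      hgap

end Parameters

/-! ### Conclusion -/

section Conclusion

/-- Lists of at least `lam` times the maximum color degree suffice, once that is large. -/
def ListRatioSuffices (C : ℕ) (lam : ℝ) : Prop :=
  ∃ D₀ : ℕ, ∀ D ≥ D₀, ∀ (V Γ ι : Type) [Fintype V] [DecidableEq V] [Fintype Γ] [DecidableEq Γ]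
    [Nonempty Γ] [Fintype ι] [DecidableEq ι] (G : ι → SimpleGraph V) (S : ι → Finset V)
    (L : V → Finset Γ), IsNearlyDisjoint G S C → ColorDegreeLE G L D →
      (∀ v, L v = ∅ ∨ lam * D ≤ (L v).card) → HasListColoring G L

lemma listRatioSuffices_of_large {C : ℕ} {lam : ℝ} (h : 16 * C + 4 ≤ lam) :
    ListRatioSuffices C lam := by
  refine ⟨1, fun D hD V Γ ι _ _ _ _ _ _ _ G S L hG hdeg hL => ?_⟩
  refine hasListColoring_of_large hG hdeg le_rfl fun v => (hL v).imp_right fun hv => ?_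
  have hD' : (1 : ℝ) ≤ D := by exact_mod_cast hD
  have : ((16 * C * D + 4 : ℕ) : ℝ) ≤ (L v).card := by
    push_cast
    nlinarith
  exact_mod_cast this

lemma ListRatioSuffices.of_mul {C : ℕ} {ε lam a η : ℝ} (hC : 1 ≤ C) (hε : 0 < ε) (hε1 : ε ≤ 1)
    (hlam : 1 + ε ≤ lam) (ha : a = ε / (64 * (C + 1) ^ 2)) (hη : η = a * ε / 100)
    (h : ListRatioSuffices C (lam * (1 + η))) : ListRatioSuffices C lam := by
  obtain ⟨D₁, hD₁⟩ := h
  obtain ⟨D₀, hD₀⟩ := Filter.eventually_atTop.1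
    (eventually_exists_parameters hC hε hε1 hlam ha hη D₁)
  refine ⟨max D₀ 1, fun D hD V Γ ι _ _ _ _ _ _ _ G S L hG hdeg hL => ?_⟩
  obtain ⟨α, p, k, t₁, t₂, h0, h1, hp, hk₁, hk₂, ht₁, hp₁, hp₂, hp₃, ht₂, hratio⟩ :=
    hD₀ D (le_of_max_le_left hD)
  have hDpos : (0 : ℝ) < D := by exact_mod_cast le_of_max_le_right hD
  obtain ⟨L₁, hL₁, hne, hcard⟩ := exists_truncation (ℓ := ⌈lam * D⌉₊)
    (Nat.ceil_pos.2 (by nlinarith)) fun v => (hL v).imp_right fun hv => Nat.ceil_le.2 hv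
  refine HasListColoring.of_subset ?_ hL₁ hne
  obtain ⟨L₂, hdeg₂, hcard₂, hcol⟩ := exists_reduction hG (hdeg.mono hL₁) hcard h0 h1 hp hk₁ hk₂ ht₁
    hp₁ hp₂ hp₃
  exact hcol (hD₁ t₂ ht₂ V Γ ι G S L₂ hG hdeg₂ fun v => (hcard₂ v).imp_right fun hv =>
    hratio.trans (by exact_mod_cast hv))

theorem listRatioSuffices {C : ℕ} {ε lam : ℝ} (hC : 1 ≤ C) (hε : 0 < ε) (hε1 : ε ≤ 1)
    (hlam : 1 + ε ≤ lam) : ListRatioSuffices C lam := by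
  obtain ⟨a, ha⟩ : ∃ a, a = ε / (64 * ((C : ℝ) + 1) ^ 2) := ⟨_, rfl⟩
  obtain ⟨η, hη⟩ : ∃ η, η = a * ε / 100 := ⟨_, rfl⟩
  have ha0 : 0 < a := by rw [ha]; positivity
  have hη0 : 0 < η := by rw [hη]; positivity
  obtain ⟨n, hn⟩ := pow_unbounded_of_one_lt (16 * (C : ℝ) + 4) (show 1 < 1 + η by linarith)
  have key : ∀ (n : ℕ) (lam : ℝ), 1 + ε ≤ lam → 16 * (C : ℝ) + 4 ≤ lam * (1 + η) ^ n →
      ListRatioSuffices C lam := by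
    intro n
    induction n with
    | zero => exact fun lam _ h => listRatioSuffices_of_large (by simpa using h)
    | succ n ih =>
      exact fun lam hlam h => .of_mul hC hε hε1 hlam ha hη
        (ih _ (by nlinarith) (by rwa [mul_assoc, ← pow_succ']))
  refine key n lam hlam (hn.le.trans ?_)
  exact le_mul_of_one_le_left (by positivity) (by linarith)

end Conclusion

end NearlyDisjoint

/-- **Main list-coloring theorem (color degrees).**
For every `C, ε > 0` there exists `D₀` such that for all `D ≥ D₀`: if `G₁, …, G_m` are
nearly disjoint graphs (with vertex sets `S i`) such that every vertex lies in at most `C`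
of them, and `L` is a list assignment for `G = ⋃ᵢ Gᵢ` with all color degrees
`Δ(Gᵢ, L|_{V(Gᵢ)}) ≤ D` and `|L(v)| ≥ (1 + ε)D`, then `G` is `L`-colorable. -/
theorem main_list_coloring (C ε : ℝ) (hC : 0 < C) (hε : 0 < ε) :
    ∃ D₀ : ℕ, ∀ D : ℕ, D₀ ≤ D →
      ∀ (V : Type) [Fintype V] [DecidableEq V] (m : ℕ) (G : Fin m → SimpleGraph V)
        [∀ i, DecidableRel (G i).Adj] (S : Fin m → Finset V) (L : V → Finset ℕ),
        (∀ i u v, (G i).Adj u v → u ∈ S i ∧ v ∈ S i) →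
        (∀ i j, i ≠ j → (S i ∩ S j).card ≤ 1) →
        (∀ v ∈ (univ : Finset (Fin m)).biUnion S,
          ((univ.filter fun i => v ∈ S i).card : ℝ) ≤ C) →
        (∀ i, ∀ v ∈ S i, ∀ c ∈ L v,
          (((G i).neighborFinset v).filter fun u => c ∈ L u).card ≤ D) →
        (∀ v ∈ (univ : Finset (Fin m)).biUnion S, (1 + ε) * D ≤ ((L v).card : ℝ)) →
        ∃ φ : V → ℕ, (∀ v ∈ (univ : Finset (Fin m)).biUnion S, φ v ∈ L v) ∧
          ∀ u v, (⨆ i, G i).Adj u v → φ u ≠ φ v := by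
  obtain ⟨D₀, hD₀⟩ := NearlyDisjoint.listRatioSuffices (Nat.one_le_ceil_iff.2 hC)
    (lt_min hε one_pos) (min_le_right ε 1) le_rfl
  refine ⟨max D₀ 1, fun D hD V _ _ m G _ S L hadj hinter hcount hdeg hcard => ?_⟩
  have hDpos : (0 : ℝ) < D := by exact_mod_cast le_of_max_le_right hD
  obtain ⟨n, hn⟩ := ((univ : Finset V).biUnion L).exists_nat_subset_range
  let W : Finset V := univ.biUnion S
  let L₁ : V → Finset (Fin (n + 1)) := fun v =>
    if v ∈ W then univ.filter fun c => (c : ℕ) ∈ L v else ∅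
  have hL₁ : ∀ v, ∀ c ∈ L₁ v, v ∈ W ∧ (c : ℕ) ∈ L v := by
    intro v c hc
    by_cases hv : v ∈ W
    · simp only [L₁, if_pos hv, mem_filter] at hc
      exact ⟨hv, hc.2⟩
    · simp [L₁, hv] at hc
  have hcard₁ : ∀ v ∈ W, (L₁ v).card = (L v).card := by
    intro v hv
    rw [← card_image_of_injective (L₁ v) Fin.val_injective]
    congr 1
    ext c
    simp only [L₁, if_pos hv, mem_image, mem_filter, mem_univ, true_and]
    refine ⟨fun ⟨c', hc', h⟩ => h ▸ hc', fun hc => ?_⟩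
    have := mem_range.1 (hn (mem_biUnion.2 ⟨v, mem_univ v, hc⟩))
    exact ⟨⟨c, by omega⟩, hc, rfl⟩
  have hne : ∀ v ∈ W, (L₁ v).Nonempty := by
    intro v hv
    rw [← card_pos, hcard₁ v hv]
    have : (0 : ℝ) < (L v).card := lt_of_lt_of_le (by positivity) (hcard v hv)
    exact_mod_cast this
  have hG : NearlyDisjoint.IsNearlyDisjoint G S ⌈C⌉₊ := by
    refine ⟨fun i u v h => (hadj i u v h).1, hinter, fun v => ?_⟩
    by_cases hv : v ∈ W
    · have := (hcount v hv).trans (Nat.le_ceil C)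
      exact_mod_cast this
    · rw [filter_false_of_mem fun i _ hi => hv (mem_biUnion.2 ⟨i, mem_univ i, hi⟩), card_empty]
      exact Nat.zero_le _
  have hdeg₁ : NearlyDisjoint.ColorDegreeLE G L₁ D := by
    intro i v c hc
    by_cases hv : v ∈ S i
    · refine (card_le_card fun u hu => ?_).trans (hdeg i v hv c (hL₁ v c hc).2)
      obtain ⟨hvu, hcu⟩ := NearlyDisjoint.mem_colorNbrs.1 hu
      exact mem_filter.2 ⟨(SimpleGraph.mem_neighborFinset _ _ _).2 hvu, (hL₁ u c hcu).2⟩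
    · rw [eq_empty_of_forall_notMem fun u hu =>
        hv (hadj i v u (NearlyDisjoint.mem_colorNbrs.1 hu).1).1, card_empty]
      exact Nat.zero_le _
  obtain ⟨φ, hφ, hproper⟩ := hD₀ D (le_of_max_le_left hD) V (Fin (n + 1)) (Fin m) G S L₁ hG
    hdeg₁ <| by
    intro v
    by_cases hv : v ∈ W
    · refine Or.inr (le_trans ?_ ((hcard v hv).trans_eq (by rw [hcard₁ v hv])))
      gcongr
      exact min_le_left ε 1
    · exact Or.inl (if_neg hv)
  refine ⟨fun v => φ v, fun v hv => (hL₁ v _ (hφ v (hne v hv))).2, fun u v huv h => ?_⟩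
  obtain ⟨i, hi⟩ := SimpleGraph.iSup_adj.1 huv
  obtain ⟨hu, hv⟩ := hadj i u v hi
  exact hproper i u v hi (hne u (mem_biUnion.2 ⟨i, mem_univ i, hu⟩))
    (hne v (mem_biUnion.2 ⟨i, mem_univ i, hv⟩)) (Fin.val_injective h)
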